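/- arXiv:1412.4089 — 3 statements merged into one kernel-verified Lean document; each statement's English description precedes it below -/
import Mathlib

section
/- With the context's notation, let h_ψ : K[u][X₁,…,X_s] → K[u,x] be the K[u]-algebra homomorphism with h_ψ(Xᵢ) = h_{fᵢ}. Then: (a) the ideal of K[X₁,…,X_s] generated by the initial forms In(G) of all nonzero G ∈ ker ψ equals the ideal (F₁,…,F_r); (b) ker h_ψ equals the ideal of K[u][X₁,…,X_s] generated by the homogenizations H_G of all nonzero G ∈ ker ψ, and this ideal equals the ideal generated by H_{G₁},…,H_{G_r}. -/
set_option synthInstance.maxHeartbeats 1000000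
set_option maxHeartbeats 1000000

/-- The set of degrees of nonzero elements of a subalgebra `A ⊆ K[x]`. -/
def dSet (K : Type*) [Field K] (A : Subalgebra K (Polynomial K)) : Set ℕ :=
  {n | ∃ f ∈ A, f ≠ 0 ∧ f.natDegree = n}

/-- The quotient `K[x]/A` has finite length as an `A`-module. -/
def FiniteLengthQuotPoly (K : Type*) [Field K] (A : Subalgebra K (Polynomial K)) : Prop :=
  IsFiniteLength A (Polynomial K ⧸ LinearMap.range (Algebra.linearMap A (Polynomial K)))

/-- The homogenization `h_f ∈ K[u][x]` of a polynomial `f = Σ_{i≤p} cᵢ xⁱ` of degree `p`: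
`h_f = Σ_{i≤p} cᵢ u^{p−i} xⁱ`. -/
noncomputable def hpoly {K : Type*} [Field K] (f : Polynomial K) :
    Polynomial (Polynomial K) :=
  ∑ i ∈ f.support,
    Polynomial.monomial i (Polynomial.monomial (f.natDegree - i) (f.coeff i))

/-- The weight `D(θ) = Σ θⱼ · d(fⱼ)` of a multi-exponent. -/
def Dweight {K : Type*} [Field K] {s : ℕ} (f : Fin s → Polynomial K)
    (θ : Fin s →₀ ℕ) : ℕ :=
  ∑ j, θ j * (f j).natDegree

/-- The `D`-degree of `G ∈ K[X₁,…,X_s]`: the largest weight of a monomial of `G`. -/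
noncomputable def Ddeg {K : Type*} [Field K] {s : ℕ} (f : Fin s → Polynomial K)
    (G : MvPolynomial (Fin s) K) : ℕ :=
  G.support.sup (Dweight f)

/-- The initial form `In(G)`: the `D`-homogeneous component of `G` of largest weight. -/
noncomputable def inFormPoly {K : Type*} [Field K] {s : ℕ} (f : Fin s → Polynomial K)
    (G : MvPolynomial (Fin s) K) : MvPolynomial (Fin s) K :=
  ∑ θ ∈ G.support.filter (fun θ => Dweight f θ = Ddeg f G),
    MvPolynomial.monomial θ (MvPolynomial.coeff θ G)

/-- The homogenization `H_G ∈ K[u][X₁,…,X_s]` of `G = Σ_k G_{p_k}` (decomposition into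
`D`-homogeneous components, `p₀ > p₁ > ⋯`): `H_G = Σ_k u^{p₀ − p_k} G_{p_k}`. -/
noncomputable def HhomPoly {K : Type*} [Field K] {s : ℕ} (f : Fin s → Polynomial K)
    (G : MvPolynomial (Fin s) K) : MvPolynomial (Fin s) (Polynomial K) :=
  ∑ θ ∈ G.support,
    MvPolynomial.monomial θ
      (Polynomial.monomial (Ddeg f G - Dweight f θ) (MvPolynomial.coeff θ G))

namespace MvPolynomial

section Homogenize

variable {R σ : Type*} [CommRing R]

/-- Homogenization in degree `m` with respect to the weight `w`: each monomial `c X^θ` becomes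
`c u^(m - w θ) X^θ`. -/
noncomputable def homogenizeAt (w : σ → ℕ) (m : ℕ) :
    MvPolynomial σ R →+ MvPolynomial σ (Polynomial R) where
  toFun G := ∑ θ ∈ G.support,
    monomial θ (Polynomial.monomial (m - Finsupp.weight w θ) (coeff θ G))
  map_zero' := by simp
  map_add' p q := by
    classical
    ext1 θ
    simp only [coeff_sum, coeff_monomial, Finset.sum_ite_eq', coeff_add]
    by_cases hp : coeff θ p = 0 <;> by_cases hq : coeff θ q = 0 <;>
      by_cases hpq : coeff θ p + coeff θ q = 0 <;>
      simp [mem_support_iff, hp, hq, hpq, ← map_add] at hpq ⊢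

theorem coeff_homogenizeAt (w : σ → ℕ) (m : ℕ) (G : MvPolynomial σ R) (θ : σ →₀ ℕ) :
    coeff θ (homogenizeAt w m G) =
      Polynomial.monomial (m - Finsupp.weight w θ) (coeff θ G) := by
  classical
  simp only [homogenizeAt, AddMonoidHom.coe_mk, ZeroHom.coe_mk, coeff_sum, coeff_monomial,
    Finset.sum_ite_eq', mem_support_iff]
  split_ifs with h
  · rfl
  · simp [not_not.1 h]

/-- The polynomials all of whose monomials have weight less than `n`. -/
noncomputable def weightLT (R : Type*) [CommRing R] (w : σ → ℕ) (n : ℕ) :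
    Submodule R (MvPolynomial σ R) :=
  restrictSupport R {θ | Finsupp.weight w θ < n}

theorem mem_weightLT {w : σ → ℕ} {n : ℕ} {G : MvPolynomial σ R} :
    G ∈ weightLT R w n ↔ ∀ θ, coeff θ G ≠ 0 → Finsupp.weight w θ < n := by
  simp only [weightLT, mem_restrictSupport_iff, Set.subset_def, Finset.mem_coe, mem_support_iff,
    Set.mem_ofPred_eq]

theorem weightLT_mono {w : σ → ℕ} {m n : ℕ} (h : m ≤ n) : weightLT R w m ≤ weightLT R w n :=
  restrictSupport_mono _ fun _ hθ => lt_of_lt_of_le hθ h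

theorem IsWeightedHomogeneous.mem_weightLT {w : σ → ℕ} {m n : ℕ} {G : MvPolynomial σ R}
    (hG : IsWeightedHomogeneous w G m) (h : m < n) : G ∈ weightLT R w n :=
  MvPolynomial.mem_weightLT.2 fun _ hθ => hG hθ ▸ h

theorem IsWeightedHomogeneous.mul_mem_weightLT {w : σ → ℕ} {m n : ℕ} {G H : MvPolynomial σ R}
    (hG : IsWeightedHomogeneous w G m) (hH : H ∈ weightLT R w n) :
    G * H ∈ weightLT R w (m + n) := by
  classical
  rw [MvPolynomial.mem_weightLT] at *
  intro θ hθ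
  rw [coeff_mul] at hθ
  obtain ⟨⟨a, b⟩, hab, h⟩ := Finset.exists_ne_zero_of_sum_ne_zero hθ
  have h1 : Finsupp.weight w a = m := hG (left_ne_zero_of_mul h)
  have h2 : Finsupp.weight w b < n := hH b (right_ne_zero_of_mul h)
  rw [← Finset.HasAntidiagonal.mem_antidiagonal.1 hab, map_add]
  exact add_lt_add_of_le_of_lt h1.le h2

theorem homogenizeAt_mul {w : σ → ℕ} {m n : ℕ} {G H : MvPolynomial σ R}
    (hG : G ∈ weightLT R w (m + 1)) (hH : H ∈ weightLT R w (n + 1)) :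
    homogenizeAt w (m + n) (G * H) = homogenizeAt w m G * homogenizeAt w n H := by
  classical
  rw [mem_weightLT] at *
  ext1 θ
  rw [coeff_homogenizeAt, coeff_mul, coeff_mul, map_sum]
  refine Finset.sum_congr rfl fun x hx => ?_
  rw [coeff_homogenizeAt, coeff_homogenizeAt, Polynomial.monomial_mul_monomial]
  by_cases h1 : coeff x.1 G = 0
  · simp [h1]
  by_cases h2 : coeff x.2 H = 0
  · simp [h2]
  have := hG _ h1
  have := hH _ h2
  rw [← Finset.HasAntidiagonal.mem_antidiagonal.1 hx, map_add]
  congr 2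
  omega

theorem homogenizeAt_add_degree {w : σ → ℕ} {m : ℕ} {G : MvPolynomial σ R}
    (hG : G ∈ weightLT R w (m + 1)) (k : ℕ) :
    homogenizeAt w (k + m) G = C (Polynomial.X ^ k) * homogenizeAt w m G := by
  rw [mem_weightLT] at hG
  ext1 θ
  rw [coeff_C_mul, coeff_homogenizeAt, coeff_homogenizeAt, Polynomial.X_pow_mul_monomial]
  by_cases h : coeff θ G = 0
  · simp [h]
  have := hG _ h
  congr 2
  omega

theorem weightedHomogeneousComponent_mul_monomial (w : σ → ℕ) (n : ℕ) (G : MvPolynomial σ R)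
    (θ : σ →₀ ℕ) (c : R) :
    weightedHomogeneousComponent w n (G * monomial θ c) =
      (if Finsupp.weight w θ ≤ n then
        weightedHomogeneousComponent w (n - Finsupp.weight w θ) G else 0) * monomial θ c := by
  classical
  ext1 d
  rw [coeff_weightedHomogeneousComponent, coeff_mul_monomial', coeff_mul_monomial']
  by_cases h : θ ≤ d
  · have hw : Finsupp.weight w d = Finsupp.weight w (d - θ) + Finsupp.weight w θ := by
      rw [← map_add, tsub_add_cancel_of_le h]
    simp only [h, if_true]
    split_ifs with h1 h2 h2
    · rw [coeff_weightedHomogeneousComponent, if_pos (by omega)]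
    · omega
    · rw [coeff_weightedHomogeneousComponent, if_neg (by omega), zero_mul]
    · simp
  · simp [h]

theorem sub_weightedHomogeneousComponent_mem_weightLT {w : σ → ℕ} {n : ℕ}
    {G : MvPolynomial σ R} (hG : G ∈ weightLT R w (n + 1)) :
    G - weightedHomogeneousComponent w n G ∈ weightLT R w n := by
  classical
  rw [mem_weightLT] at *
  intro θ hθ
  rw [coeff_sub, coeff_weightedHomogeneousComponent] at hθ
  split_ifs at hθ with h
  · simp at hθ
  · have := hG θ (by simpa using hθ)
    omega

/-- The slice in degree `m` of a polynomial over `R[u]`, where `u` has weight one,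
dehomogenized by setting `u = 1`. -/
noncomputable def dehomogenizeAt (w : σ → ℕ) (m : ℕ) (N : MvPolynomial σ (Polynomial R)) :
    MvPolynomial σ R :=
  ∑ θ ∈ N.support, monomial θ
    (if Finsupp.weight w θ ≤ m then (coeff θ N).coeff (m - Finsupp.weight w θ) else 0)

theorem coeff_dehomogenizeAt (w : σ → ℕ) (m : ℕ) (N : MvPolynomial σ (Polynomial R))
    (θ : σ →₀ ℕ) :
    coeff θ (dehomogenizeAt w m N) =
      if Finsupp.weight w θ ≤ m then (coeff θ N).coeff (m - Finsupp.weight w θ) else 0 := by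
  classical
  simp only [dehomogenizeAt, coeff_sum, coeff_monomial, Finset.sum_ite_eq', mem_support_iff]
  by_cases h : coeff θ N = 0 <;> simp [h]

theorem dehomogenizeAt_mem_weightLT (w : σ → ℕ) (m : ℕ)
    (N : MvPolynomial σ (Polynomial R)) : dehomogenizeAt w m N ∈ weightLT R w (m + 1) := by
  refine mem_weightLT.2 fun θ hθ => ?_
  rw [coeff_dehomogenizeAt] at hθ
  exact Nat.lt_succ_of_le (not_lt.1 fun h => hθ (if_neg (by omega)))

theorem exists_sum_homogenizeAt_dehomogenizeAt (w : σ → ℕ)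
    (N : MvPolynomial σ (Polynomial R)) :
    ∃ M, ∑ m ∈ Finset.range M, homogenizeAt w m (dehomogenizeAt w m N) = N := by
  classical
  refine ⟨(N.support.sup fun θ => Finsupp.weight w θ + (coeff θ N).natDegree) + 1, ?_⟩
  ext θ k
  simp only [coeff_sum, Polynomial.finsetSum_coeff, coeff_homogenizeAt, coeff_dehomogenizeAt,
    Polynomial.coeff_monomial]
  rw [Finset.sum_eq_single (k + Finsupp.weight w θ)]
  · simp
  · intro m _ hm
    split_ifs <;> first | rfl | omega
  · intro hk
    simp only [add_tsub_cancel_right, le_add_iff_nonneg_left, zero_le, if_true]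
    by_contra hne
    have hN : coeff θ N ≠ 0 := by
      rintro h
      simp [h] at hne
    have h1 := Polynomial.le_natDegree_of_ne_zero hne
    have h2 := Finset.le_sup (f := fun θ => Finsupp.weight w θ + (coeff θ N).natDegree)
      (mem_support_iff.2 hN)
    simp only [Finset.mem_range] at hk
    omega

end Homogenize

section Univariate

variable {K : Type*} [Field K] {s : ℕ} (f : Fin s → Polynomial K)

theorem aeval_eq_sum_C (G : MvPolynomial (Fin s) K) :
    aeval f G = ∑ θ ∈ G.support, Polynomial.C (coeff θ G) * ∏ i, f i ^ θ i := by
  rw [aeval_def, eval₂_eq']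
  rfl

theorem Dweight_eq_weight (θ : Fin s →₀ ℕ) :
    Dweight f θ = Finsupp.weight (fun i => (f i).natDegree) θ := by
  simp [Dweight, Finsupp.weight_apply, Finsupp.sum_fintype]

theorem mem_weightLT_Ddeg (G : MvPolynomial (Fin s) K) :
    G ∈ weightLT K (fun i => (f i).natDegree) (Ddeg f G + 1) := by
  refine mem_weightLT.2 fun θ hθ => ?_
  rw [← Dweight_eq_weight]
  exact Nat.lt_succ_of_le (Finset.le_sup (mem_support_iff.2 hθ))

theorem Ddeg_le {G : MvPolynomial (Fin s) K} {n : ℕ}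
    (hG : G ∈ weightLT K (fun i => (f i).natDegree) (n + 1)) : Ddeg f G ≤ n := by
  refine Finset.sup_le fun θ hθ => ?_
  rw [Dweight_eq_weight]
  exact Nat.le_of_lt_succ (mem_weightLT.1 hG θ (mem_support_iff.1 hθ))

theorem inFormPoly_eq (G : MvPolynomial (Fin s) K) :
    inFormPoly f G =
      weightedHomogeneousComponent (fun i => (f i).natDegree) (Ddeg f G) G := by
  classical
  rw [weightedHomogeneousComponent_apply, inFormPoly]
  simp only [Dweight_eq_weight]

theorem HhomPoly_eq (G : MvPolynomial (Fin s) K) :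
    HhomPoly f G = homogenizeAt (fun i => (f i).natDegree) (Ddeg f G) G := by
  simp only [HhomPoly, homogenizeAt, AddMonoidHom.coe_mk, ZeroHom.coe_mk, Dweight_eq_weight]

theorem homogenizeAt_eq_mul_HhomPoly {G : MvPolynomial (Fin s) K} {n : ℕ}
    (hG : G ∈ weightLT K (fun i => (f i).natDegree) (n + 1)) :
    homogenizeAt (fun i => (f i).natDegree) n G =
      C (Polynomial.X ^ (n - Ddeg f G)) * HhomPoly f G := by
  rw [HhomPoly_eq, ← homogenizeAt_add_degree (mem_weightLT_Ddeg f G),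
    Nat.sub_add_cancel (Ddeg_le f hG)]

variable {f}

theorem aeval_X_pow_weightedHomogeneousComponent (hf : ∀ i, (f i).Monic) {n : ℕ}
    {G : MvPolynomial (Fin s) K} (hG : G ∈ weightLT K (fun i => (f i).natDegree) (n + 1)) :
    aeval (fun i => (Polynomial.X : Polynomial K) ^ (f i).natDegree)
        (weightedHomogeneousComponent (fun i => (f i).natDegree) n G) =
      Polynomial.monomial n ((aeval f G).coeff n) := by
  classical
  rw [weightedHomogeneousComponent_apply, map_sum, aeval_eq_sum_C, Polynomial.finsetSum_coeff,
    map_sum, Finset.sum_filter]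
  refine Finset.sum_congr rfl fun θ hθ => ?_
  have hmon : (∏ i, f i ^ θ i).Monic :=
    Polynomial.monic_prod_of_monic _ _ fun i _ => (hf i).pow _
  have hdeg : (∏ i, f i ^ θ i).natDegree = Finsupp.weight (fun i => (f i).natDegree) θ := by
    rw [Polynomial.natDegree_prod_of_monic _ _ fun i _ => (hf i).pow _, ← Dweight_eq_weight,
      Dweight]
    exact Finset.sum_congr rfl fun i _ => (hf i).natDegree_pow _
  rw [Polynomial.coeff_C_mul]
  split_ifs with h
  · rw [← h, ← hdeg, hmon.coeff_natDegree, mul_one, hdeg, aeval_monomial,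
      Finsupp.prod_fintype _ _ (by simp), ← Dweight_eq_weight, Dweight,
      ← Polynomial.C_mul_X_pow_eq_monomial, ← Finset.prod_pow_eq_pow_sum]
    simp only [← pow_mul, mul_comm]
    rfl
  · have := mem_weightLT.1 hG θ (mem_support_iff.1 hθ)
    rw [Polynomial.coeff_eq_zero_of_natDegree_lt (by omega)]
    simp

theorem hpoly_comp (p : Polynomial K) :
    (hpoly p).comp (Polynomial.C Polynomial.X * Polynomial.X) =
      Polynomial.C (Polynomial.X ^ p.natDegree) * p.map Polynomial.C := by
  ext1 n
  rw [Polynomial.comp_C_mul_X_coeff, Polynomial.coeff_C_mul, Polynomial.coeff_map, hpoly,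
    Polynomial.finsetSum_coeff]
  simp only [Polynomial.coeff_monomial, Finset.sum_ite_eq', Polynomial.mem_support_iff]
  split_ifs with h
  · rw [Polynomial.monomial_mul_X_pow, Nat.sub_add_cancel (Polynomial.le_natDegree_of_mem_supp n h),
      mul_comm, Polynomial.C_mul_X_pow_eq_monomial]
  · simp [Polynomial.notMem_support_iff.1 h]

theorem comp_C_X_mul_X_injective :
    Function.Injective fun p : Polynomial (Polynomial K) =>
      p.comp (Polynomial.C Polynomial.X * Polynomial.X) := by
  intro p q h
  ext1 n
  have := congrArg (fun r => Polynomial.coeff r n) h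
  simp only [Polynomial.comp_C_mul_X_coeff] at this
  exact mul_right_cancel₀ (pow_ne_zero _ Polynomial.X_ne_zero) this

theorem aeval_hpoly_comp (N : MvPolynomial (Fin s) (Polynomial K)) :
    (aeval (R := Polynomial K) (fun i => hpoly (f i)) N).comp
        (Polynomial.C Polynomial.X * Polynomial.X) =
      ∑ θ ∈ N.support, Polynomial.C
        (coeff θ N * Polynomial.X ^ Finsupp.weight (fun i => (f i).natDegree) θ) *
          (∏ i, f i ^ θ i).map Polynomial.C := by
  rw [aeval_def, eval₂_eq', Polynomial.sum_comp]
  refine Finset.sum_congr rfl fun θ _ => ?_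
  rw [Polynomial.mul_comp, Polynomial.prod_comp, ← Dweight_eq_weight, Dweight,
    ← Finset.prod_pow_eq_pow_sum, Polynomial.C_mul, mul_assoc, Polynomial.map_prod, map_prod,
    ← Finset.prod_mul_distrib]
  congr 1
  · exact Polynomial.C_comp
  · refine Finset.prod_congr rfl fun i _ => ?_
    rw [Polynomial.pow_comp, hpoly_comp, mul_pow, Polynomial.map_pow, ← map_pow, ← pow_mul,
      mul_comm (θ i)]

theorem aeval_hpoly_homogenizeAt_comp {m : ℕ} {G : MvPolynomial (Fin s) K}
    (hG : G ∈ weightLT K (fun i => (f i).natDegree) (m + 1)) :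
    (aeval (R := Polynomial K) (fun i => hpoly (f i))
        (homogenizeAt (fun i => (f i).natDegree) m G)).comp
        (Polynomial.C Polynomial.X * Polynomial.X) =
      Polynomial.C (Polynomial.X ^ m) * (aeval f G).map Polynomial.C := by
  have hsupp : (homogenizeAt (fun i => (f i).natDegree) m G).support = G.support := by
    ext θ
    simp [coeff_homogenizeAt]
  rw [aeval_hpoly_comp, hsupp, aeval_eq_sum_C, Polynomial.map_sum, Finset.mul_sum]
  refine Finset.sum_congr rfl fun θ hθ => ?_
  have := mem_weightLT.1 hG θ (mem_support_iff.1 hθ)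
  rw [coeff_homogenizeAt, Polynomial.monomial_mul_X_pow, Nat.sub_add_cancel (by omega),
    Polynomial.map_mul, Polynomial.map_C, ← mul_assoc, ← Polynomial.C_mul, mul_comm (_ ^ _),
    Polynomial.C_mul_X_pow_eq_monomial]

theorem aeval_dehomogenizeAt_eq_zero {N : MvPolynomial (Fin s) (Polynomial K)}
    (hN : aeval (R := Polynomial K) (fun i => hpoly (f i)) N = 0) (m : ℕ) :
    aeval f (dehomogenizeAt (fun i => (f i).natDegree) m N) = 0 := by
  ext j
  have h := congrArg (fun r => (Polynomial.coeff r j).coeff m) (aeval_hpoly_comp (f := f) N)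
  simp only [hN, Polynomial.zero_comp, Polynomial.coeff_zero, Polynomial.finsetSum_coeff,
    Polynomial.coeff_C_mul, Polynomial.coeff_map, Polynomial.coeff_mul_C,
    Polynomial.coeff_mul_X_pow'] at h
  rw [dehomogenizeAt, map_sum, Polynomial.finsetSum_coeff, Polynomial.coeff_zero]
  refine Eq.trans ?_ h.symm
  refine Finset.sum_congr rfl fun θ _ => ?_
  rw [aeval_monomial, Finsupp.prod_fintype _ _ (by simp)]
  rw [Polynomial.algebraMap_eq, Polynomial.coeff_C_mul, ite_mul, zero_mul]

section Binomials

variable {r : ℕ} (α β : Fin r → (Fin s →₀ ℕ)) (P : Fin r → MvPolynomial (Fin s) K)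

theorem weight_eq_of_binomial_mem_ker {a b : Fin s →₀ ℕ}
    (h : (monomial a (1 : K) - monomial b 1) ∈
      RingHom.ker (aeval fun i => (Polynomial.X : Polynomial K) ^ (f i).natDegree)) :
    Finsupp.weight (fun i => (f i).natDegree) a = Finsupp.weight (fun i => (f i).natDegree) b := by
  have key : ∀ c : Fin s →₀ ℕ,
      aeval (fun i => (Polynomial.X : Polynomial K) ^ (f i).natDegree) (monomial c (1 : K)) =
        Polynomial.X ^ Finsupp.weight (fun i => (f i).natDegree) c := fun c => by
    rw [aeval_monomial, Finsupp.prod_fintype _ _ (by simp), ← Dweight_eq_weight, Dweight,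
      ← Finset.prod_pow_eq_pow_sum]
    simp only [← pow_mul, mul_comm (c _), map_one, one_mul]
  rw [RingHom.mem_ker, map_sub, key, key, sub_eq_zero] at h
  simpa using congrArg Polynomial.natDegree h

theorem binomial_sub_mem_weightLT
    (hker : RingHom.ker (aeval fun i => (Polynomial.X : Polynomial K) ^ (f i).natDegree) =
      Ideal.span (Set.range fun i => monomial (α i) (1 : K) - monomial (β i) 1))
    (hP : ∀ i, P i ∈ weightLT K (fun i => (f i).natDegree)
      (Finsupp.weight (fun i => (f i).natDegree) (α i))) (i : Fin r) :
    monomial (α i) (1 : K) - monomial (β i) 1 - P i ∈ weightLT K (fun i => (f i).natDegree)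
      (Finsupp.weight (fun i => (f i).natDegree) (α i) + 1) := by
  have hαβ := weight_eq_of_binomial_mem_ker (f := f) (a := α i) (b := β i)
    (hker ▸ Ideal.subset_span ⟨i, rfl⟩)
  refine sub_mem (sub_mem ?_ ?_) (weightLT_mono (Nat.le_succ _) (hP i))
  · exact (isWeightedHomogeneous_monomial _ _ _ rfl).mem_weightLT (Nat.lt_succ_self _)
  · exact (isWeightedHomogeneous_monomial _ _ _ hαβ.symm).mem_weightLT (Nat.lt_succ_self _)

theorem weightedHomogeneousComponent_binomial_sub
    (hker : RingHom.ker (aeval fun i => (Polynomial.X : Polynomial K) ^ (f i).natDegree) =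
      Ideal.span (Set.range fun i => monomial (α i) (1 : K) - monomial (β i) 1))
    (hP : ∀ i, P i ∈ weightLT K (fun i => (f i).natDegree)
      (Finsupp.weight (fun i => (f i).natDegree) (α i))) (i : Fin r) :
    weightedHomogeneousComponent (fun i => (f i).natDegree)
      (Finsupp.weight (fun i => (f i).natDegree) (α i))
      (monomial (α i) (1 : K) - monomial (β i) 1 - P i) =
        monomial (α i) (1 : K) - monomial (β i) 1 := by
  have hαβ := weight_eq_of_binomial_mem_ker (f := f) (a := α i) (b := β i)
    (hker ▸ Ideal.subset_span ⟨i, rfl⟩)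
  rw [map_sub, IsWeightedHomogeneous.weightedHomogeneousComponent_same
    ((isWeightedHomogeneous_monomial _ _ _ rfl).sub
      (isWeightedHomogeneous_monomial _ _ _ hαβ.symm)),
    weightedHomogeneousComponent_eq_zero', sub_zero]
  exact fun θ hθ => (mem_weightLT.1 (hP i) θ (mem_support_iff.1 hθ)).ne

/-- Reduction step: the leading component of an element of `ker ψ` can be cancelled by a
combination of the `Gᵢ = Fᵢ − Pᵢ` with homogeneous coefficients. -/
theorem exists_sub_sum_mem_weightLT (hf : ∀ i, (f i).Monic)
    (hker : RingHom.ker (aeval fun i => (Polynomial.X : Polynomial K) ^ (f i).natDegree) =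
      Ideal.span (Set.range fun i => monomial (α i) (1 : K) - monomial (β i) 1))
    (hP : ∀ i, P i ∈ weightLT K (fun i => (f i).natDegree)
      (Finsupp.weight (fun i => (f i).natDegree) (α i)))
    {n : ℕ} {G : MvPolynomial (Fin s) K} (hG : G ∈ weightLT K (fun i => (f i).natDegree) (n + 1))
    (hG0 : aeval f G = 0) :
    ∃ q : Fin r → MvPolynomial (Fin s) K,
      (∀ i, q i ≠ 0 → Finsupp.weight (fun i => (f i).natDegree) (α i) ≤ n ∧
        IsWeightedHomogeneous (fun i => (f i).natDegree) (q i)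
          (n - Finsupp.weight (fun i => (f i).natDegree) (α i))) ∧
      G - ∑ i, q i * (monomial (α i) (1 : K) - monomial (β i) 1 - P i) ∈
        weightLT K (fun i => (f i).natDegree) n := by
  set w : Fin s → ℕ := fun i => (f i).natDegree with hw
  have hαβ : ∀ i, Finsupp.weight w (α i) = Finsupp.weight w (β i) := fun i =>
    weight_eq_of_binomial_mem_ker (hker ▸ Ideal.subset_span ⟨i, rfl⟩)
  have hmem : weightedHomogeneousComponent w n G ∈
      Ideal.span (Set.range fun i => monomial (α i) (1 : K) - monomial (β i) 1) := by
    rw [← hker, RingHom.mem_ker, aeval_X_pow_weightedHomogeneousComponent hf hG, hG0]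
    simp
  obtain ⟨c, hc⟩ := Ideal.mem_span_range_iff_exists_fun.1 hmem
  let q : Fin r → MvPolynomial (Fin s) K := fun i =>
    if Finsupp.weight w (α i) ≤ n then
      weightedHomogeneousComponent w (n - Finsupp.weight w (α i)) (c i) else 0
  have hq : ∀ i, q i ≠ 0 → Finsupp.weight w (α i) ≤ n ∧
      IsWeightedHomogeneous w (q i) (n - Finsupp.weight w (α i)) := fun i hi => by
    have h : Finsupp.weight w (α i) ≤ n := not_lt.1 fun h => hi (if_neg (by omega))
    refine ⟨h, ?_⟩
    simp only [q, if_pos h]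
    exact weightedHomogeneousComponent_isWeightedHomogeneous _ _
  refine ⟨q, hq, ?_⟩
  have hcomp : weightedHomogeneousComponent w n G =
      ∑ i, q i * (monomial (α i) (1 : K) - monomial (β i) 1) := by
    have hself := (weightedHomogeneousComponent_isWeightedHomogeneous
      (w := w) n G).weightedHomogeneousComponent_same
    rw [← hself, ← hc, map_sum]
    refine Finset.sum_congr rfl fun i _ => ?_
    rw [mul_sub, map_sub, weightedHomogeneousComponent_mul_monomial,
      weightedHomogeneousComponent_mul_monomial, ← hαβ i, ← mul_sub]
  have hsplit : G - ∑ i, q i * (monomial (α i) (1 : K) - monomial (β i) 1 - P i) =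
      (G - weightedHomogeneousComponent w n G) + ∑ i, q i * P i := by
    rw [hcomp]
    simp only [mul_sub, Finset.sum_sub_distrib]
    ring
  rw [hsplit]
  refine add_mem (sub_weightedHomogeneousComponent_mem_weightLT hG) (sum_mem fun i _ => ?_)
  by_cases hi : q i = 0
  · rw [hi, zero_mul]
    exact zero_mem _
  · obtain ⟨h1, h2⟩ := hq i hi
    have := h2.mul_mem_weightLT (hP i)
    rwa [Nat.sub_add_cancel h1] at this

theorem homogenizeAt_mem_span (hf : ∀ i, (f i).Monic)
    (hker : RingHom.ker (aeval fun i => (Polynomial.X : Polynomial K) ^ (f i).natDegree) =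
      Ideal.span (Set.range fun i => monomial (α i) (1 : K) - monomial (β i) 1))
    (hP : ∀ i, P i ∈ weightLT K (fun i => (f i).natDegree)
      (Finsupp.weight (fun i => (f i).natDegree) (α i)))
    (hP0 : ∀ i, aeval f (monomial (α i) (1 : K) - monomial (β i) 1 - P i) = 0)
    (n m : ℕ) (hnm : n ≤ m + 1) (G : MvPolynomial (Fin s) K)
    (hG : G ∈ weightLT K (fun i => (f i).natDegree) n) (hG0 : aeval f G = 0) :
    homogenizeAt (fun i => (f i).natDegree) m G ∈ Ideal.span (Set.range fun i =>
      HhomPoly f (monomial (α i) (1 : K) - monomial (β i) 1 - P i)) := by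
  induction n generalizing G with
  | zero =>
    have : G = 0 := by
      ext1 θ
      by_contra h
      exact absurd (mem_weightLT.1 hG θ h) (by omega)
    rw [this, map_zero]
    exact zero_mem _
  | succ n ih =>
    obtain ⟨q, hq, hlt⟩ := exists_sub_sum_mem_weightLT α β P hf hker hP hG hG0
    rw [← sub_add_cancel G (∑ i, q i * (monomial (α i) (1 : K) - monomial (β i) 1 - P i)),
      map_add, map_sum]
    refine add_mem (ih (by omega) _ hlt ?_) (sum_mem fun i _ => ?_)
    · rw [map_sub, hG0, map_sum, Finset.sum_eq_zero, sub_zero]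
      intro i _
      rw [map_mul, hP0, mul_zero]
    · by_cases hi : q i = 0
      · rw [hi, zero_mul, map_zero]
        exact zero_mem _
      obtain ⟨h1, h2⟩ := hq i hi
      have hGi := binomial_sub_mem_weightLT α β P hker hP i
      rw [← Nat.sub_add_cancel (show Finsupp.weight (fun i => (f i).natDegree) (α i) ≤ m by omega),
        homogenizeAt_mul (h2.mem_weightLT (by omega)) hGi, homogenizeAt_eq_mul_HhomPoly f hGi]
      exact Ideal.mul_mem_left _ _ (Ideal.mul_mem_left _ _ (Ideal.subset_span ⟨i, rfl⟩))

end Binomials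

end Univariate

end MvPolynomial

/-- (a) The ideal of `K[X₁,…,X_s]` generated by the initial forms of the nonzero elements
of `ker ψ` equals `(F₁,…,F_r)`; (b) the kernel of
`h_ψ : K[u][X₁,…,X_s] → K[u,x]`, `Xᵢ ↦ h_{fᵢ}` (a `K[u]`-algebra map), equals the ideal
generated by the homogenizations `H_G` of nonzero `G ∈ ker ψ`, and the latter equals the
ideal generated by `H_{G₁},…,H_{G_r}` where `Gᵢ = Fᵢ − Pᵢ`. -/
theorem stmt_15 (K : Type*) [Field K] {s r : ℕ} (f : Fin s → Polynomial K)
    (hmonic : ∀ i, (f i).Monic) (hdeg : ∀ i, 0 < (f i).natDegree)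
    (hlen : FiniteLengthQuotPoly K (Algebra.adjoin K (Set.range f)))
    (hbasis : dSet K (Algebra.adjoin K (Set.range f))
        = ↑(AddSubmonoid.closure (Set.range fun j => (f j).natDegree)))
    (α β : Fin r → (Fin s →₀ ℕ))
    (hker : RingHom.ker (MvPolynomial.aeval fun i =>
        (Polynomial.X : Polynomial K) ^ (f i).natDegree)
      = Ideal.span (Set.range fun i =>
          (MvPolynomial.monomial (α i) (1 : K) - MvPolynomial.monomial (β i) (1 : K))))
    (P : Fin r → MvPolynomial (Fin s) K)
    (hP : ∀ i, MvPolynomial.aeval f (P i)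
      = (∏ j, f j ^ (α i) j) - (∏ j, f j ^ (β i) j))
    (hPweight : ∀ i, ∀ θ ∈ (P i).support,
      Dweight f θ < ∑ j, (α i) j * (f j).natDegree) :
    (Ideal.span {Q : MvPolynomial (Fin s) K |
        ∃ G, G ∈ RingHom.ker (MvPolynomial.aeval f) ∧ G ≠ 0 ∧ Q = inFormPoly f G}
      = Ideal.span (Set.range fun i =>
          MvPolynomial.monomial (α i) (1 : K) - MvPolynomial.monomial (β i) (1 : K))) ∧
    (RingHom.ker (MvPolynomial.aeval (R := Polynomial K) fun i => hpoly (f i))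
      = Ideal.span {Q : MvPolynomial (Fin s) (Polynomial K) |
          ∃ G, G ∈ RingHom.ker (MvPolynomial.aeval f) ∧ G ≠ 0 ∧ Q = HhomPoly f G}) ∧
    (Ideal.span {Q : MvPolynomial (Fin s) (Polynomial K) |
          ∃ G, G ∈ RingHom.ker (MvPolynomial.aeval f) ∧ G ≠ 0 ∧ Q = HhomPoly f G}
      = Ideal.span (Set.range fun i => HhomPoly f
          (MvPolynomial.monomial (α i) (1 : K) - MvPolynomial.monomial (β i) (1 : K)
            - P i))) := by
  have hw : ∀ θ, Dweight f θ = Finsupp.weight (fun i => (f i).natDegree) θ :=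
    MvPolynomial.Dweight_eq_weight f
  have hPlt : ∀ i, P i ∈ MvPolynomial.weightLT K (fun i => (f i).natDegree)
      (Finsupp.weight (fun i => (f i).natDegree) (α i)) := fun i => by
    refine MvPolynomial.mem_weightLT.2 fun θ hθ => ?_
    rw [← hw, ← hw]
    exact hPweight i θ (MvPolynomial.mem_support_iff.2 hθ)
  have hP0 : ∀ i, MvPolynomial.aeval f
      (MvPolynomial.monomial (α i) (1 : K) - MvPolynomial.monomial (β i) 1 - P i) = 0 := by
    intro i
    rw [map_sub, map_sub, hP, MvPolynomial.aeval_monomial, MvPolynomial.aeval_monomial,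
      Finsupp.prod_fintype _ _ (by simp), Finsupp.prod_fintype _ _ (by simp)]
    simp
  have hsub : Ideal.span {Q : MvPolynomial (Fin s) (Polynomial K) |
        ∃ G, G ∈ RingHom.ker (MvPolynomial.aeval f) ∧ G ≠ 0 ∧ Q = HhomPoly f G} ≤
      Ideal.span (Set.range fun i => HhomPoly f
        (MvPolynomial.monomial (α i) (1 : K) - MvPolynomial.monomial (β i) (1 : K) - P i)) := by
    rw [Ideal.span_le]
    rintro _ ⟨G, hG, -, rfl⟩
    rw [MvPolynomial.HhomPoly_eq]
    exact MvPolynomial.homogenizeAt_mem_span α β P hmonic hker hPlt hP0 _ _ le_rfl G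
      (MvPolynomial.mem_weightLT_Ddeg f G) hG
  refine ⟨le_antisymm ?_ ?_, le_antisymm ?_ ?_, le_antisymm hsub ?_⟩
  · rw [Ideal.span_le]
    rintro _ ⟨G, hG, -, rfl⟩
    rw [← hker, MvPolynomial.inFormPoly_eq, SetLike.mem_coe, RingHom.mem_ker,
      MvPolynomial.aeval_X_pow_weightedHomogeneousComponent hmonic
        (MvPolynomial.mem_weightLT_Ddeg f G), (RingHom.mem_ker).1 hG]
    simp
  · rw [Ideal.span_le]
    rintro _ ⟨i, rfl⟩
    rw [SetLike.mem_coe]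
    have hlt := MvPolynomial.binomial_sub_mem_weightLT α β P hker hPlt i
    have hcomp := MvPolynomial.weightedHomogeneousComponent_binomial_sub α β P hker hPlt i
    by_cases hF : MvPolynomial.monomial (α i) (1 : K) - MvPolynomial.monomial (β i) 1 = 0
    · simp only [hF, zero_mem]
    refine Ideal.subset_span ⟨_, hP0 i, fun h => hF ?_, ?_⟩
    · rw [← hcomp, h, map_zero]
    · have hD := le_antisymm (MvPolynomial.Ddeg_le f hlt) <| not_lt.1 fun hne =>
        hF <| hcomp.symm.trans <|
          MvPolynomial.weightedHomogeneousComponent_eq_zero' _ _ fun θ hθ => by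
            have := MvPolynomial.mem_weightLT.1 (MvPolynomial.mem_weightLT_Ddeg f _) θ
              (MvPolynomial.mem_support_iff.1 hθ)
            omega
      rw [MvPolynomial.inFormPoly_eq, hD, hcomp]
  · intro N hN
    obtain ⟨M, hM⟩ := MvPolynomial.exists_sum_homogenizeAt_dehomogenizeAt
      (fun i => (f i).natDegree) N
    rw [← hM]
    refine sum_mem fun m _ => ?_
    rw [MvPolynomial.homogenizeAt_eq_mul_HhomPoly f
      (MvPolynomial.dehomogenizeAt_mem_weightLT _ m N)]
    refine Ideal.mul_mem_left _ _ ?_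
    by_cases h0 : MvPolynomial.dehomogenizeAt (fun i => (f i).natDegree) m N = 0
    · simp [h0, HhomPoly]
    · exact Ideal.subset_span ⟨_, MvPolynomial.aeval_dehomogenizeAt_eq_zero hN m, h0, rfl⟩
  · rw [Ideal.span_le]
    rintro _ ⟨G, hG, -, rfl⟩
    refine MvPolynomial.comp_C_X_mul_X_injective ?_
    beta_reduce
    rw [MvPolynomial.HhomPoly_eq]
    refine (MvPolynomial.aeval_hpoly_homogenizeAt_comp
      (MvPolynomial.mem_weightLT_Ddeg f G)).trans ?_
    rw [(RingHom.mem_ker).1 hG]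
    simp
  · rw [Ideal.span_le]
    rintro _ ⟨i, rfl⟩
    by_cases h0 : MvPolynomial.monomial (α i) (1 : K) - MvPolynomial.monomial (β i) 1 - P i = 0
    · simp [h0, HhomPoly]
    · exact Ideal.subset_span ⟨_, hP0 i, h0, rfl⟩
end

section
/- Let K be a field and g₁,…,g_l ∈ K[x] polynomials such that the K-subalgebra A = K[g₁,…,g_l] of K[x] satisfies that ℕ∖d(A) is finite (where d(A) = {deg f : f ∈ A, f ≠ 0}). Then there exist s ∈ ℕ, natural numbers a₁,…,a_s generating the numerical semigroup d(A), and an ideal J of the polynomial ring K[u][X₁,…,X_s], such that: (i) the quotient K[u][X₁,…,X_s]/J is flat as a K[u]-module; (ii) K[u][X₁,…,X_s]/(J + (u − 1)) is isomorphic as a K-algebra to A; (iii) K[u][X₁,…,X_s]/(J + (u)) is isomorphic as a K-algebra to the K-subalgebra K[x^{a₁},…,x^{a_s}] of K[x] generated by the monomials x^{a₁},…,x^{a_s}. -/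
set_option synthInstance.maxHeartbeats 1000000
set_option maxHeartbeats 1000000

open Polynomial in
/-- The homomorphism `K[u][X₁,…,X_s] → K[x][u]` fixing `u` and sending `X_i` to `f_i u^{a_i}`. -/
noncomputable def reesHom {K σ : Type*} [Field K] (a : σ → ℕ) (f : σ → K[X]) :
    MvPolynomial σ K[X] →+* K[X][X] :=
  MvPolynomial.eval₂Hom (mapRingHom C) fun i => C (f i) * X ^ a i

namespace reesHom

open Polynomial

variable {K σ : Type*} [Field K] {a : σ → ℕ} {f : σ → K[X]}

@[simp]
lemma apply_C (r : K[X]) : reesHom a f (MvPolynomial.C r) = r.map C := by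
  simp [reesHom]

@[simp]
lemma apply_X (i : σ) : reesHom a f (MvPolynomial.X i) = C (f i) * X ^ a i := by
  simp [reesHom]

/-- The fiber of `reesHom` at `u = 1`. -/
noncomputable def fiberOne (a : σ → ℕ) (f : σ → K[X]) : MvPolynomial σ K[X] →ₐ[K] K[X] where
  toRingHom := (evalRingHom 1).comp (reesHom a f)
  commutes' r := by simp [MvPolynomial.algebraMap_apply]

lemma fiberOne_apply (F : MvPolynomial σ K[X]) :
    fiberOne a f F = (reesHom a f F).eval 1 := rfl

/-- The fiber at `u = 0`: evaluate `u` at `0` and send `X_i` to `x^{a_i}`. -/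
noncomputable def fiberZero (a : σ → ℕ) : MvPolynomial σ K[X] →ₐ[K] K[X] where
  toRingHom := MvPolynomial.eval₂Hom (C.comp (evalRingHom 0)) fun i => X ^ a i
  commutes' r := by simp [MvPolynomial.algebraMap_apply]

@[simp]
lemma fiberZero_C (r : K[X]) :
    fiberZero a (MvPolynomial.C r) = C (r.eval 0) :=
  MvPolynomial.eval₂_C _ _ _

@[simp]
lemma fiberZero_X (i : σ) :
    fiberZero (K := K) a (MvPolynomial.X i) = X ^ a i :=
  MvPolynomial.eval₂_X _ _ _

lemma coeff_mem {A : Subalgebra K K[X]} (hA : ∀ i, f i ∈ A) (F : MvPolynomial σ K[X]) :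
    ∀ n, (reesHom a f F).coeff n ∈ A := by
  induction F using MvPolynomial.induction_on with
  | C r =>
    intro n
    simpa using A.algebraMap_mem (r.coeff n)
  | add p q hp hq =>
    intro n
    simpa using A.add_mem (hp n) (hq n)
  | mul_X p i hp =>
    intro n
    rw [map_mul, coeff_mul]
    refine A.sum_mem fun x _ => A.mul_mem (hp _) ?_
    rw [apply_X, coeff_C_mul_X_pow]
    split_ifs
    exacts [hA i, A.zero_mem]

lemma coeff_spec (hf : ∀ i, (f i).Monic) (hdeg : ∀ i, (f i).natDegree = a i)
    (F : MvPolynomial σ K[X]) :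
    ∀ n, ((reesHom a f F).coeff n).natDegree ≤ n ∧
      ((reesHom a f F).coeff n).coeff n = (fiberZero a F).coeff n := by
  induction F using MvPolynomial.induction_on with
  | C r =>
    intro n
    rcases n with _ | n <;> simp [coeff_zero_eq_eval_zero]
  | add p q hp hq =>
    intro n
    simp only [map_add, coeff_add]
    exact ⟨natDegree_add_le_of_degree_le (hp n).1 (hq n).1, by rw [(hp n).2, (hq n).2]⟩
  | mul_X p i hp =>
    have hX : ∀ n, ((reesHom a f (MvPolynomial.X i)).coeff n).natDegree ≤ n ∧
        ((reesHom a f (MvPolynomial.X i)).coeff n).coeff n =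
          (fiberZero a (MvPolynomial.X i) : K[X]).coeff n := by
      intro n
      rw [apply_X, coeff_C_mul_X_pow, fiberZero_X, coeff_X_pow]
      split_ifs with h
      · subst h
        refine ⟨(hdeg i).le, ?_⟩
        rw [← hdeg i]
        exact hf i
      · simp
    intro n
    rw [map_mul, map_mul, coeff_mul, coeff_mul, finsetSum_coeff]
    refine ⟨natDegree_sum_le_of_forall_le _ _ fun x hx => ?_, Finset.sum_congr rfl fun x hx => ?_⟩
    · rw [← Finset.HasAntidiagonal.mem_antidiagonal.mp hx]
      exact natDegree_mul_le_of_le (hp _).1 (hX _).1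
    · rw [← Finset.HasAntidiagonal.mem_antidiagonal.mp hx,
        coeff_mul_add_eq_of_natDegree_le (hp _).1 (hX _).1, (hp _).2, (hX _).2]

lemma exists_monic {A : Subalgebra K K[X]} (hf : ∀ i, (f i).Monic)
    (hdeg : ∀ i, (f i).natDegree = a i) (hA : ∀ i, f i ∈ A) {n : ℕ}
    (hn : n ∈ AddSubmonoid.closure (Set.range a)) :
    ∃ F, ∃ h ∈ A, h.Monic ∧ h.natDegree = n ∧ reesHom a f F = C h * X ^ n := by
  induction hn using AddSubmonoid.closure_induction with
  | mem x hx =>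
    obtain ⟨i, rfl⟩ := hx
    exact ⟨MvPolynomial.X i, f i, hA i, hf i, hdeg i, apply_X i⟩
  | zero => exact ⟨1, 1, A.one_mem, monic_one, natDegree_one, by simp⟩
  | add x y _ _ hx hy =>
    obtain ⟨F, h, hh, hm, hd, hF⟩ := hx
    obtain ⟨G, k, hk, hm', hd', hG⟩ := hy
    refine ⟨F * G, h * k, A.mul_mem hh hk, hm.mul hm', by rw [hm.natDegree_mul hm', hd, hd'], ?_⟩
    rw [map_mul, hF, hG, C_mul]
    ring

lemma exists_eq_C_mul_X_pow {A : Subalgebra K K[X]} (hf : ∀ i, (f i).Monic)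
    (hdeg : ∀ i, (f i).natDegree = a i) (hA : ∀ i, f i ∈ A)
    (hcl : ∀ p ∈ A, p ≠ 0 → p.natDegree ∈ AddSubmonoid.closure (Set.range a)) (n : ℕ) :
    ∀ p ∈ A, p.natDegree ≤ n → ∃ F, reesHom a f F = C p * X ^ n := by
  induction n with
  | zero =>
    intro p _ hp
    refine ⟨MvPolynomial.C (C (p.coeff 0)), ?_⟩
    rw [apply_C, map_C, ← eq_C_of_natDegree_le_zero hp]
    simp
  | succ n ih =>
    have key : ∀ p ∈ A, p.natDegree ≤ n + 1 → p.coeff (n + 1) = 0 →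
        ∃ F, reesHom a f F = C p * X ^ (n + 1) := by
      intro p hpA hp h0
      obtain ⟨F, hF⟩ := ih p hpA (natDegree_le_pred hp h0)
      refine ⟨MvPolynomial.C X * F, ?_⟩
      rw [map_mul, hF, apply_C, map_X]
      ring
    intro p hpA hp
    by_cases h0 : p.coeff (n + 1) = 0
    · exact key p hpA hp h0
    have hpn : p.natDegree = n + 1 := le_antisymm hp (le_natDegree_of_ne_zero h0)
    obtain ⟨F, h, hhA, hm, hd, hF⟩ := exists_monic hf hdeg hA
      (hpn ▸ hcl p hpA (by rintro rfl; simp at h0))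
    obtain ⟨G, hG⟩ := key (p - C (p.coeff (n + 1)) * h)
      (A.sub_mem hpA (A.mul_mem (A.algebraMap_mem _) hhA))
      ((natDegree_sub_le_of_le hp ((natDegree_C_mul_le _ _).trans hd.le)).trans_eq (max_self _))
      (by
        have : h.coeff (n + 1) = 1 := by rw [← hd]; exact hm
        simp [this])
    refine ⟨MvPolynomial.C (C (p.coeff (n + 1))) * F + G, ?_⟩
    rw [map_add, map_mul, hF, hG, apply_C, map_C, C_sub, C_mul]
    ring

lemma exists_eq {A : Subalgebra K K[X]} (hf : ∀ i, (f i).Monic)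
    (hdeg : ∀ i, (f i).natDegree = a i) (hA : ∀ i, f i ∈ A)
    (hcl : ∀ p ∈ A, p ≠ 0 → p.natDegree ∈ AddSubmonoid.closure (Set.range a))
    (q : K[X][X]) (hqA : ∀ n, q.coeff n ∈ A) (hq : ∀ n, (q.coeff n).natDegree ≤ n) :
    ∃ F, reesHom a f F = q := by
  choose F hF using fun n => exists_eq_C_mul_X_pow hf hdeg hA hcl n _ (hqA n) (hq n)
  refine ⟨∑ n ∈ Finset.range (q.natDegree + 1), F n, ?_⟩
  rw [map_sum, Finset.sum_congr rfl fun n _ => hF n]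
  exact q.as_sum_range_C_mul_X_pow.symm

instance isTorsionFree_quotient_ker :
    Module.IsTorsionFree K[X] (MvPolynomial σ K[X] ⧸ RingHom.ker (reesHom a f)) := by
  refine .of_smul_eq_zero fun r m h => ?_
  obtain ⟨F, rfl⟩ := Ideal.Quotient.mk_surjective m
  have h' : MvPolynomial.C r * F ∈ RingHom.ker (reesHom a f) := by
    rw [← Ideal.Quotient.eq_zero_iff_mem, ← MvPolynomial.smul_eq_C_mul]
    exact h
  rw [RingHom.mem_ker, map_mul, apply_C, mul_eq_zero, Polynomial.map_eq_zero_iff C_injective] at h'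
  exact h'.imp id fun h => Ideal.Quotient.eq_zero_iff_mem.mpr h

lemma ker_eq_sup {θ : MvPolynomial σ K[X] →ₐ[K] K[X]} {r : K[X]}
    (hr : θ (MvPolynomial.C r) = 0) (hle : ∀ F, reesHom a f F = 0 → θ F = 0)
    (hdvd : ∀ F, θ F = 0 → ∃ G, reesHom a f F = r.map C * reesHom a f G) :
    RingHom.ker (reesHom a f) ⊔ Ideal.span {MvPolynomial.C r} = RingHom.ker θ := by
  refine le_antisymm (sup_le hle ?_) fun F hF => ?_
  · rwa [Ideal.span_singleton_le_iff_mem]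
  · obtain ⟨G, hG⟩ := hdvd F hF
    rw [← sub_add_cancel F (MvPolynomial.C r * G)]
    refine Ideal.add_mem _ (Ideal.mem_sup_left ?_)
      (Ideal.mem_sup_right (Ideal.mul_mem_right _ _ (Ideal.mem_span_singleton_self _)))
    rw [RingHom.mem_ker, map_sub, map_mul, apply_C, hG, sub_self]

lemma nonempty_algEquiv {θ : MvPolynomial σ K[X] →ₐ[K] K[X]} {I : Ideal (MvPolynomial σ K[X])}
    {B : Subalgebra K K[X]} (hI : I = RingHom.ker θ) (hB : θ.range = B) :
    Nonempty ((MvPolynomial σ K[X] ⧸ I) ≃ₐ[K] B) := by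
  subst hI hB
  exact ⟨Ideal.quotientKerEquivRange θ⟩

section Fibers

variable {A : Subalgebra K K[X]} (hf : ∀ i, (f i).Monic) (hdeg : ∀ i, (f i).natDegree = a i)
  (hA : ∀ i, f i ∈ A)
  (hcl : ∀ p ∈ A, p ≠ 0 → p.natDegree ∈ AddSubmonoid.closure (Set.range a))

include hf hdeg hA hcl

lemma range_fiberOne : (fiberOne a f).range = A := by
  ext p
  constructor
  · rintro ⟨F, rfl⟩
    change (reesHom a f F).eval 1 ∈ A
    rw [eval_eq_sum_range]
    exact A.sum_mem fun n _ => by simpa using coeff_mem hA F n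
  · intro hp
    obtain ⟨F, hF⟩ := exists_eq_C_mul_X_pow hf hdeg hA hcl _ p hp le_rfl
    exact ⟨F, by simp [fiberOne_apply, hF]⟩

omit hf hdeg hA hcl in
lemma range_fiberZero :
    (fiberZero (K := K) a).range = Algebra.adjoin K (Set.range fun i => (X : K[X]) ^ a i) := by
  apply le_antisymm
  · rintro _ ⟨F, rfl⟩
    change fiberZero (K := K) a F ∈ _
    induction F using MvPolynomial.induction_on with
    | C r => rw [fiberZero_C]; exact Subalgebra.algebraMap_mem _ (r.eval 0)
    | add p q hp hq => rw [map_add]; exact add_mem hp hq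
    | mul_X p i hp =>
      rw [map_mul, fiberZero_X]
      exact mul_mem hp (Algebra.subset_adjoin ⟨i, rfl⟩)
  · refine Algebra.adjoin_le ?_
    rintro _ ⟨i, rfl⟩
    exact ⟨MvPolynomial.X i, fiberZero_X i⟩

lemma ker_fiberOne :
    RingHom.ker (reesHom a f) ⊔ Ideal.span {MvPolynomial.C (X - 1)} =
      RingHom.ker (fiberOne a f) := by
  refine ker_eq_sup (by simp [fiberOne_apply]) (fun F hF => by simp [fiberOne_apply, hF])
    fun F hF => ?_
  obtain ⟨q, hq⟩ : X - C 1 ∣ reesHom a f F := dvd_iff_isRoot.mpr hF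
  have hc : ∀ n, q.coeff n ∈ A ∧ (q.coeff n).natDegree ≤ n := by
    intro n
    induction n with
    | zero =>
      have h : q.coeff 0 = -(reesHom a f F).coeff 0 := by simp [hq, sub_mul]
      rw [h, natDegree_neg]
      exact ⟨A.neg_mem (coeff_mem hA F 0), (coeff_spec hf hdeg F 0).1⟩
    | succ n ih =>
      have h : q.coeff (n + 1) = q.coeff n - (reesHom a f F).coeff (n + 1) := by
        simp [hq, sub_mul]
      rw [h]
      exact ⟨A.sub_mem ih.1 (coeff_mem hA F _),
        (natDegree_sub_le_of_le (ih.2.trans n.le_succ) (coeff_spec hf hdeg F _).1).trans_eq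
          (max_self _)⟩
  obtain ⟨G, hG⟩ := exists_eq hf hdeg hA hcl q (fun n => (hc n).1) fun n => (hc n).2
  exact ⟨G, by simp [hq, hG]⟩

lemma ker_fiberZero :
    RingHom.ker (reesHom a f) ⊔ Ideal.span {MvPolynomial.C X} =
      RingHom.ker (fiberZero (K := K) a) := by
  refine ker_eq_sup (by simp) (fun F hF => ?_) fun F hF => ?_
  · ext n
    rw [← (coeff_spec hf hdeg F n).2, hF]
    simp
  have hlt : ∀ n, ((reesHom a f F).coeff n).coeff n = 0 := fun n => by
    rw [(coeff_spec hf hdeg F n).2, hF, coeff_zero]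
  obtain ⟨q, hq⟩ : X ∣ reesHom a f F := by
    rw [X_dvd_iff, eq_C_of_natDegree_le_zero (coeff_spec hf hdeg F 0).1, hlt, C_0]
  have hc : ∀ n, q.coeff n = (reesHom a f F).coeff (n + 1) := by simp [hq]
  obtain ⟨G, hG⟩ := exists_eq hf hdeg hA hcl q (fun n => hc n ▸ coeff_mem hA F _) fun n => by
    rw [hc]
    exact natDegree_le_pred (coeff_spec hf hdeg F (n + 1)).1 (hlt (n + 1))
  exact ⟨G, by simp [hq, hG]⟩

end Fibers

end reesHom

/-- The degrees of nonzero elements of a subalgebra of `K[x]` form a submonoid of `ℕ`. -/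
def dSetSubmonoid (K : Type*) [Field K] (A : Subalgebra K (Polynomial K)) : AddSubmonoid ℕ where
  carrier := dSet K A
  zero_mem' := ⟨1, A.one_mem, one_ne_zero, Polynomial.natDegree_one⟩
  add_mem' := by
    rintro _ _ ⟨p, hp, hp0, rfl⟩ ⟨q, hq, hq0, rfl⟩
    exact ⟨p * q, A.mul_mem hp hq, mul_ne_zero hp0 hq0, Polynomial.natDegree_mul hp0 hq0⟩

lemma exists_closure_range_eq_dSet (K : Type*) [Field K] (A : Subalgebra K (Polynomial K)) :
    ∃ (s : ℕ) (a : Fin s → ℕ), (↑(AddSubmonoid.closure (Set.range a)) : Set ℕ) = dSet K A := by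
  obtain ⟨S, hS⟩ := Nat.addSubmonoid_fg (dSetSubmonoid K A)
  refine ⟨S.card, fun i => S.equivFin.symm i, ?_⟩
  have : (Set.range fun i => (S.equivFin.symm i : ℕ)) = S := by
    rw [← Function.comp_def, S.equivFin.symm.surjective.range_comp, Subtype.range_coe]
  rw [this, hS]
  rfl

lemma exists_monic_of_mem_dSet {K : Type*} [Field K] {A : Subalgebra K (Polynomial K)} {n : ℕ}
    (hn : n ∈ dSet K A) : ∃ f ∈ A, f.Monic ∧ f.natDegree = n := by
  obtain ⟨p, hp, hp0, rfl⟩ := hn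
  exact ⟨p * Polynomial.C p.leadingCoeff⁻¹, A.mul_mem hp (A.algebraMap_mem _),
    Polynomial.monic_mul_leadingCoeff_inv hp0, Polynomial.natDegree_mul_leadingCoeff_inv p hp0⟩

/-- Every polynomial space curve parametrized by `g₁,…,g_l` (with `ℕ ∖ d(A)` finite for
`A = K[g₁,…,g_l]`) has a flat deformation into a monomial curve: there are generators
`a₁,…,a_s` of the numerical semigroup `d(A)` and an ideal `J` of `K[u][X₁,…,X_s]` whose
quotient is `K[u]`-flat, with fiber at `u = 1` isomorphic to `A` and fiber at `u = 0`
isomorphic to `K[x^{a₁},…,x^{a_s}]`. -/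
theorem stmt_16 (K : Type*) [Field K] {l : ℕ} (g : Fin l → Polynomial K)
    (hfin : ((dSet K (Algebra.adjoin K (Set.range g)))ᶜ).Finite) :
    ∃ (s : ℕ) (a : Fin s → ℕ) (J : Ideal (MvPolynomial (Fin s) (Polynomial K))),
      (↑(AddSubmonoid.closure (Set.range a)) : Set ℕ)
          = dSet K (Algebra.adjoin K (Set.range g)) ∧
      Module.Flat (Polynomial K) (MvPolynomial (Fin s) (Polynomial K) ⧸ J) ∧
      Nonempty
        ((MvPolynomial (Fin s) (Polynomial K) ⧸
            (J ⊔ Ideal.span {MvPolynomial.C (Polynomial.X - 1)}))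
          ≃ₐ[K] Algebra.adjoin K (Set.range g)) ∧
      Nonempty
        ((MvPolynomial (Fin s) (Polynomial K) ⧸
            (J ⊔ Ideal.span {MvPolynomial.C (Polynomial.X : Polynomial K)}))
          ≃ₐ[K] Algebra.adjoin K
              (Set.range fun i => (Polynomial.X : Polynomial K) ^ a i)) := by
  obtain ⟨s, a, ha⟩ := exists_closure_range_eq_dSet K (Algebra.adjoin K (Set.range g))
  have hmem (i : Fin s) : a i ∈ dSet K (Algebra.adjoin K (Set.range g)) :=
    ha ▸ AddSubmonoid.subset_closure ⟨i, rfl⟩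
  choose f hA hf hdeg using fun i => exists_monic_of_mem_dSet (hmem i)
  have hcl : ∀ p ∈ Algebra.adjoin K (Set.range g), p ≠ 0 →
      p.natDegree ∈ AddSubmonoid.closure (Set.range a) := fun p hp hp0 => by
    rw [← SetLike.mem_coe, ha]
    exact ⟨p, hp, hp0, rfl⟩
  exact ⟨s, a, RingHom.ker (reesHom a f), ha, inferInstance,
    reesHom.nonempty_algEquiv (reesHom.ker_fiberOne hf hdeg hA hcl)
      (reesHom.range_fiberOne hf hdeg hA hcl),
    reesHom.nonempty_algEquiv (reesHom.ker_fiberZero hf hdeg hA hcl) reesHom.range_fiberZero⟩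
end

section
/- Let K be an algebraically closed field of characteristic zero and let f, g ∈ K[x] be monic polynomials with n = deg f > deg g = m ≥ 1. If K[f,g] = K[x] (the parametrization x ↦ (f(x),g(x)) has polynomial inverse, i.e. f and g generate K[x] as a K-algebra), then m divides n. -/
set_option synthInstance.maxHeartbeats 1000000
set_option maxHeartbeats 1000000

open Polynomial

namespace PlaneLine

variable {K : Type*} [Field K]

/-- Substitution `(x, y) ↦ (f, g)` of two univariate polynomials in a polynomial of `K[x][y]`. -/
noncomputable def subst (f g : K[X]) : K[X][X] →+* K[X] :=
  eval₂RingHom (compRingHom f) g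

@[simp] lemma subst_C (f g a : K[X]) : subst f g (C a) = a.comp f := by
  simp [subst]

@[simp] lemma subst_X (f g : K[X]) : subst f g X = g := by
  simp [subst]

/-- The degree of `Q(f, g)`, normalised as if the leading coefficient of `Q` were one. -/
noncomputable def val (f g : K[X]) (Q : K[X][X]) : ℤ :=
  ((subst f g Q).natDegree : ℤ) - f.natDegree * Q.leadingCoeff.natDegree

/-- No nonzero polynomial of `y`-degree less than `deg f` vanishes at `(f, g)`. -/
def Indep (f g : K[X]) : Prop :=
  ∀ Q : K[X][X], Q ≠ 0 → Q.natDegree < f.natDegree → subst f g Q ≠ 0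

/-- `e k` has `y`-degree `k` and minimises the normalised degree, for all `k < deg f`. -/
structure IsMinimal (f g : K[X]) (e : ℕ → K[X][X]) : Prop where
  ne_zero : ∀ k < f.natDegree, e k ≠ 0
  natDegree_eq : ∀ k < f.natDegree, (e k).natDegree = k
  val_le : ∀ Q : K[X][X], Q ≠ 0 → Q.natDegree < f.natDegree →
    val f g (e Q.natDegree) ≤ val f g Q

variable {f g : K[X]} {e : ℕ → K[X][X]}

lemma val_mul {Q R : K[X][X]} (hQ : subst f g Q ≠ 0) (hR : subst f g R ≠ 0) :
    val f g (Q * R) = val f g Q + val f g R := by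
  have hQ0 : Q ≠ 0 := fun h => hQ (by simp [h])
  have hR0 : R ≠ 0 := fun h => hR (by simp [h])
  unfold val
  rw [map_mul, natDegree_mul hQ hR, leadingCoeff_mul,
    natDegree_mul (leadingCoeff_ne_zero.mpr hQ0) (leadingCoeff_ne_zero.mpr hR0)]
  push_cast
  ring

lemma val_one : val f g 1 = 0 := by simp [val]

lemma val_pow {Q : K[X][X]} (hQ : subst f g Q ≠ 0) (j : ℕ) :
    val f g (Q ^ j) = j * val f g Q := by
  induction j with
  | zero => simp [val_one]
  | succ j ih =>
    rw [pow_succ, val_mul (by rw [map_pow]; exact pow_ne_zero _ hQ) hQ, ih]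
    push_cast
    ring

/-- Subtracting a polynomial of smaller `y`-degree whose normalised degree is congruent modulo
`deg f` lowers the normalised degree. -/
lemma exists_val_lt (hf : f.Monic) (hI : Indep f g) {Q R : K[X][X]}
    (hQ : Q ≠ 0) (hR : R ≠ 0) (hRQ : R.natDegree < Q.natDegree)
    (hQn : Q.natDegree < f.natDegree)
    (hmod : (f.natDegree : ℤ) ∣ val f g Q - val f g R) :
    ∃ S : K[X][X], S ≠ 0 ∧ S.natDegree = Q.natDegree ∧ val f g S < val f g Q := by
  have ha := hI Q hQ hQn
  have hb := hI R hR (hRQ.trans hQn)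
  set a := subst f g Q with hadef
  set b := subst f g R with hbdef
  obtain ⟨s, t, hst⟩ : ∃ s t : ℕ,
      a.natDegree + f.natDegree * s = b.natDegree + f.natDegree * t := by
    obtain ⟨w, hw⟩ := hmod
    unfold val at hw
    rw [← hadef, ← hbdef] at hw
    set u : ℤ := w + Q.leadingCoeff.natDegree - R.leadingCoeff.natDegree with hu
    have h1 : (a.natDegree : ℤ) - b.natDegree = f.natDegree * u := by rw [hu]; linarith
    refine ⟨(-u).toNat, u.toNat, ?_⟩
    zify
    have h2 : ((u.toNat : ℤ)) - ((-u).toNat : ℤ) = u := by omega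
    rw [← h2] at h1
    linarith
  set c := a.leadingCoeff / b.leadingCoeff with hc
  have hb' := leadingCoeff_ne_zero.mpr hb
  have ha' := leadingCoeff_ne_zero.mpr ha
  have hc0 : c ≠ 0 := div_ne_zero ha' hb'
  have hXs : (X ^ s : K[X]) ≠ 0 := pow_ne_zero _ X_ne_zero
  have hCs : (C (X ^ s : K[X]) : K[X][X]) ≠ 0 := C_ne_zero.mpr hXs
  have hA : (C (X ^ s) * Q).natDegree = Q.natDegree := by
    rw [natDegree_mul hCs hQ, natDegree_C, zero_add]
  have hlt : (C (C c * X ^ t) * R).degree < (C (X ^ s) * Q).degree := by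
    apply degree_lt_degree
    rw [hA]
    exact (natDegree_C_mul_le _ _).trans_lt hRQ
  set S := C (X ^ s) * Q - C (C c * X ^ t) * R with hS
  have hSd : S.natDegree = Q.natDegree := by
    rw [hS, natDegree_sub_eq_left_of_natDegree_lt, hA]
    rw [hA]
    exact (natDegree_C_mul_le _ _).trans_lt hRQ
  have hSl : S.leadingCoeff = X ^ s * Q.leadingCoeff := by
    rw [hS, leadingCoeff_sub_of_degree_lt hlt, leadingCoeff_mul, leadingCoeff_C]
  have hS0 : S ≠ 0 := by
    rw [← leadingCoeff_ne_zero, hSl]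
    exact mul_ne_zero hXs (leadingCoeff_ne_zero.mpr hQ)
  have hSe : subst f g S = f ^ s * a - C c * f ^ t * b := by
    simp [hS, hadef, hbdef]
  have hne := hI S hS0 (hSd ▸ hQn)
  have hd1 : (f ^ s * a).natDegree = a.natDegree + f.natDegree * s := by
    rw [(hf.pow s).natDegree_mul' ha, hf.natDegree_pow]; ring
  have hd2 : (C c * f ^ t * b).natDegree = b.natDegree + f.natDegree * t := by
    rw [mul_assoc, natDegree_C_mul hc0, (hf.pow t).natDegree_mul' hb, hf.natDegree_pow]; ring
  have h10 : f ^ s * a ≠ 0 := mul_ne_zero (hf.pow s).ne_zero ha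
  have h20 : C c * f ^ t * b ≠ 0 :=
    mul_ne_zero (mul_ne_zero (C_ne_zero.mpr hc0) (hf.pow t).ne_zero) hb
  have hdeg : (subst f g S).degree < (f ^ s * a).degree := by
    rw [hSe]
    apply degree_sub_lt_left _ h10
    · simp [leadingCoeff_mul, hf.leadingCoeff, hc, hb']
    · rw [degree_eq_natDegree h10, degree_eq_natDegree h20, hd1, hd2, hst]
  have hnat := natDegree_lt_natDegree hne hdeg
  refine ⟨S, hS0, hSd, ?_⟩
  unfold val
  rw [hSl, natDegree_mul hXs (leadingCoeff_ne_zero.mpr hQ), natDegree_X_pow]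
  rw [hd1] at hnat
  zify at hnat
  push_cast
  rw [← hadef]
  linarith

namespace IsMinimal

lemma subst_ne_zero (he : IsMinimal f g e) (hI : Indep f g) {k : ℕ} (hk : k < f.natDegree) :
    subst f g (e k) ≠ 0 :=
  hI _ (he.ne_zero k hk) (by rwa [he.natDegree_eq k hk])

/-- The minimal normalised degrees are pairwise incongruent modulo `deg f`. -/
lemma not_dvd_sub (he : IsMinimal f g e) (hf : f.Monic) (hI : Indep f g) {i k : ℕ}
    (hik : i < k) (hk : k < f.natDegree) :
    ¬ (f.natDegree : ℤ) ∣ val f g (e k) - val f g (e i) := by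
  intro h
  have hi := hik.trans hk
  have hdk := he.natDegree_eq k hk
  have hdi := he.natDegree_eq i hi
  obtain ⟨S, hS0, hSd, hlt⟩ := exists_val_lt hf hI (he.ne_zero k hk) (he.ne_zero i hi)
    (by rwa [hdk, hdi]) (by rwa [hdk]) h
  have := he.val_le S hS0 (by rwa [hSd, hdk])
  rw [hSd, hdk] at this
  exact absurd hlt (not_lt.mpr this)

/-- A normalised degree is either minimal or congruent to a minimal one of smaller index. -/
lemma val_eq_or (he : IsMinimal f g e) (hI : Indep f g) (i : ℕ) :
    ∀ R : K[X][X], R ≠ 0 → R.natDegree = i → i < f.natDegree →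
      val f g R = val f g (e i) ∨
        ∃ j < i, (f.natDegree : ℤ) ∣ val f g R - val f g (e j) := by
  induction i using Nat.strong_induction_on with
  | _ i ih =>
  intro R hR hRi hi
  rcases (he.val_le R hR (hRi ▸ hi)).eq_or_lt with h | h
  · left; rw [← h, hRi]
  right
  rw [hRi] at h
  have hEi := he.ne_zero i hi
  have hdi := he.natDegree_eq i hi
  set E := (e i).leadingCoeff with hE
  set r := R.leadingCoeff with hr
  have hE0 : E ≠ 0 := leadingCoeff_ne_zero.mpr hEi
  have hr0 : r ≠ 0 := leadingCoeff_ne_zero.mpr hR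
  have hsR := hI R hR (hRi ▸ hi)
  have hsE := he.subst_ne_zero hI hi
  set S := C E * R - C r * e i with hS
  have hfpos : 0 < f.natDegree := by omega
  have hcomp : ∀ a : K[X], a ≠ 0 → a.comp f ≠ 0 := by
    intro a ha h0
    rw [← subst_C f g] at h0
    exact hI (C a) (C_ne_zero.mpr ha) (by simpa using hfpos) h0
  have hd1 : (E.comp f * subst f g R).natDegree =
      E.natDegree * f.natDegree + (subst f g R).natDegree := by
    rw [natDegree_mul (hcomp E hE0) hsR, natDegree_comp]
  have hd2 : (r.comp f * subst f g (e i)).natDegree =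
      r.natDegree * f.natDegree + (subst f g (e i)).natDegree := by
    rw [natDegree_mul (hcomp r hr0) hsE, natDegree_comp]
  have hlt : (r.comp f * subst f g (e i)).natDegree < (E.comp f * subst f g R).natDegree := by
    rw [hd1, hd2]
    unfold val at h
    rw [← hE, ← hr] at h
    zify
    linarith
  have hSs : (subst f g S).natDegree = E.natDegree * f.natDegree + (subst f g R).natDegree := by
    rw [hS, map_sub, map_mul, map_mul, subst_C, subst_C,
      natDegree_sub_eq_left_of_natDegree_lt hlt, hd1]
  have hS0 : S ≠ 0 := by
    intro h0
    have : E.comp f * subst f g R = r.comp f * subst f g (e i) := by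
      rw [← sub_eq_zero, ← subst_C f g, ← subst_C f g, ← map_mul, ← map_mul, ← map_sub, ← hS, h0,
        map_zero]
    rw [this] at hlt
    exact lt_irrefl _ hlt
  have hCE : (C E : K[X][X]) ≠ 0 := C_ne_zero.mpr hE0
  have hCr : (C r : K[X][X]) ≠ 0 := C_ne_zero.mpr hr0
  have hSd : S.natDegree < i := by
    have : S.degree < (C E * R).degree := by
      apply degree_sub_lt_left
      · rw [degree_eq_natDegree (mul_ne_zero hCE hR), degree_eq_natDegree (mul_ne_zero hCr hEi),
          natDegree_C_mul hE0, natDegree_C_mul hr0, hRi, hdi]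
      · exact mul_ne_zero hCE hR
      · rw [leadingCoeff_mul, leadingCoeff_mul, leadingCoeff_C, leadingCoeff_C, mul_comm]
    have := natDegree_lt_natDegree hS0 this
    rwa [natDegree_C_mul hE0, hRi] at this
  have hval : (f.natDegree : ℤ) ∣ val f g R - val f g S := by
    unfold val
    rw [hSs]
    push_cast
    exact ⟨S.leadingCoeff.natDegree - r.natDegree - E.natDegree, by ring⟩
  rcases ih S.natDegree hSd S hS0 rfl (hSd.trans hi) with h1 | ⟨j, hj, h1⟩
  · exact ⟨S.natDegree, hSd, h1 ▸ hval⟩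
  · exact ⟨j, hj.trans hSd, by simpa using dvd_add hval h1⟩


lemma eq_of_dvd_sub (he : IsMinimal f g e) (hf : f.Monic) (hI : Indep f g) {i k : ℕ}
    (hi : i < f.natDegree) (hk : k < f.natDegree)
    (h : (f.natDegree : ℤ) ∣ val f g (e k) - val f g (e i)) : i = k := by
  rcases lt_trichotomy i k with hik | hik | hik
  · exact absurd h (he.not_dvd_sub hf hI hik hk)
  · exact hik
  · exact absurd ((dvd_sub_comm).mp h) (he.not_dvd_sub hf hI hik hi)

lemma exists_dvd_sub (he : IsMinimal f g e) (hf : f.Monic) (hI : Indep f g) {N d : ℕ}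
    (hN : 0 < N) (hd : 0 < d) (hn : f.natDegree = N * d)
    (hdvd : ∀ i < N, (d : ℤ) ∣ val f g (e i)) {w : ℤ} (hw : (d : ℤ) ∣ w) :
    ∃ i < N, (f.natDegree : ℤ) ∣ w - val f g (e i) := by
  have hNn : N ≤ f.natDegree := by rw [hn]; exact Nat.le_mul_of_pos_right _ hd
  choose! u hu using hdvd
  obtain ⟨w', rfl⟩ := hw
  have : NeZero N := ⟨hN.ne'⟩
  have key : ∀ a b : ℤ, (a : ZMod N) = (b : ZMod N) →
      (f.natDegree : ℤ) ∣ (d : ℤ) * a - d * b := by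
    intro a b hab
    obtain ⟨c, hc⟩ := (ZMod.intCast_eq_intCast_iff_dvd_sub b a N).mp hab.symm
    refine ⟨c, ?_⟩
    rw [← mul_sub, hc, hn]
    push_cast
    ring
  have hinj : Function.Injective (fun i : Fin N => ((u i : ℤ) : ZMod N)) := by
    intro i j hij
    have := key _ _ hij
    rw [← hu i i.2, ← hu j j.2] at this
    exact Fin.ext (he.eq_of_dvd_sub hf hI (j.2.trans_le hNn) (i.2.trans_le hNn) this).symm
  have hbij := (Fintype.bijective_iff_injective_and_card _).mpr ⟨hinj, by simp [ZMod.card]⟩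
  obtain ⟨i, hi⟩ := hbij.2 (w' : ZMod N)
  refine ⟨i, i.2, ?_⟩
  rw [hu i i.2]
  exact key _ _ hi.symm

/-- If the first `N` minimal degrees are the multiples of `d = deg f / N` modulo `deg f`, then the
next ones are obtained by adding multiples of the `N`-th one. -/
lemma val_eq_add (he : IsMinimal f g e) (hf : f.Monic) (hI : Indep f g) {N d q d' : ℕ}
    (hN : 0 < N) (hNn : N < f.natDegree) (hn : f.natDegree = N * d)
    (hdvd : ∀ i < N, (d : ℤ) ∣ val f g (e i)) (hd' : 0 < d') (hq : d = q * d')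
    (hgcd : ∀ a : ℤ, (d : ℤ) ∣ a * val f g (e N) → (q : ℤ) ∣ a) (k : ℕ) :
    k < q * N → val f g (e k) = val f g (e (k % N)) + (k / N : ℕ) * val f g (e N) := by
  induction k using Nat.strong_induction_on with
  | _ k ih =>
  intro hk
  have hkn : k < f.natDegree := by
    rw [hn, hq]
    calc k < q * N := hk
      _ ≤ (q * N) * d' := Nat.le_mul_of_pos_right _ hd'
      _ = _ := by ring
  have hr : k % N < N := Nat.mod_lt _ hN
  have hrn := hr.trans hNn
  have hs1 := he.subst_ne_zero hI hrn
  have hs2 := he.subst_ne_zero hI hNn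
  have hs3 : subst f g (e N ^ (k / N)) ≠ 0 := by rw [map_pow]; exact pow_ne_zero _ hs2
  have h0 : e (k % N) * e N ^ (k / N) ≠ 0 :=
    mul_ne_zero (he.ne_zero _ hrn) (pow_ne_zero _ (he.ne_zero _ hNn))
  have hdeg : (e (k % N) * e N ^ (k / N)).natDegree = k := by
    rw [natDegree_mul (he.ne_zero _ hrn) (pow_ne_zero _ (he.ne_zero _ hNn)), natDegree_pow,
      he.natDegree_eq _ hrn, he.natDegree_eq _ hNn]
    exact Nat.mod_add_div' k N
  have hv : val f g (e (k % N) * e N ^ (k / N)) =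
      val f g (e (k % N)) + (k / N : ℕ) * val f g (e N) := by
    rw [val_mul hs1 hs3, val_pow hs2]
  rcases he.val_eq_or hI k _ h0 hdeg hkn with h | ⟨j, hj, h⟩
  · rw [← h, hv]
  exfalso
  rw [hv, ih j hj (hj.trans hk)] at h
  have hjr : j % N < N := Nat.mod_lt _ hN
  have hdn : (d : ℤ) ∣ f.natDegree := ⟨N, by rw [hn]; push_cast; ring⟩
  have h1 : (q : ℤ) ∣ ((k / N : ℕ) : ℤ) - (j / N : ℕ) := by
    apply hgcd
    have := dvd_sub (hdn.trans h) (dvd_sub (hdvd _ hr) (hdvd _ hjr))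
    exact this.trans (dvd_of_eq (by ring))
  have hkq : k / N < q := Nat.div_lt_of_lt_mul (by rwa [mul_comm])
  have hjq : j / N < q := Nat.div_lt_of_lt_mul (by rw [mul_comm]; exact hj.trans hk)
  have h2 : k / N = j / N := by
    generalize k / N = a at *
    generalize j / N = b at *
    have := Int.eq_zero_of_abs_lt_dvd h1 (by rw [abs_lt]; constructor <;> omega)
    omega
  rw [h2] at h
  have h3 : j % N = k % N := he.eq_of_dvd_sub hf hI (hjr.trans hNn) hrn (by
    simpa using h)
  have e1 := Nat.mod_add_div k N
  have e2 := Nat.mod_add_div j N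
  rw [h2, ← h3, e2] at e1
  exact hj.ne e1

end IsMinimal

lemma natDegree_geom_sum₂_le {S : Type*} [CommRing S] {N : ℕ} (d : ℕ) {A B : S[X]}
    (hA : A.natDegree ≤ N) (hB : B.natDegree ≤ N) :
    (∑ a ∈ Finset.range d, A ^ a * B ^ (d - 1 - a)).natDegree ≤ N * (d - 1) := by
  refine natDegree_sum_le_of_forall_le _ _ fun a ha => ?_
  rw [Finset.mem_range] at ha
  refine (natDegree_mul_le_of_le (natDegree_pow_le_of_le a hA)
    (natDegree_pow_le_of_le (d - 1 - a) hB)).trans (le_of_eq ?_)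
  rw [← add_mul, mul_comm]
  congr 1
  omega

lemma coeff_geom_sum₂ {S : Type*} [CommRing S] {N : ℕ} (d : ℕ) {A B : S[X]} {D : S}
    (hA : A.natDegree ≤ N) (hB : B.natDegree ≤ N) (hAD : A.coeff N = D) (hBD : B.coeff N = D) :
    (∑ a ∈ Finset.range d, A ^ a * B ^ (d - 1 - a)).coeff (N * (d - 1)) = d * D ^ (d - 1) := by
  rw [finsetSum_coeff, Finset.sum_congr rfl (g := fun _ => D ^ (d - 1))]
  · simp
  intro a ha
  rw [Finset.mem_range] at ha
  have h1 : N * (d - 1) = a * N + (d - 1 - a) * N := by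
    rw [← add_mul, mul_comm]
    congr 1
    omega
  rw [h1, coeff_mul_add_eq_of_natDegree_le (natDegree_pow_le_of_le a hA)
    (natDegree_pow_le_of_le (d - 1 - a) hB),
    coeff_pow_of_natDegree_le hA, coeff_pow_of_natDegree_le hB, hAD, hBD, ← pow_add]
  congr 1
  omega

/-- Approximate roots of monic polynomials. -/
lemma exists_approx_root {S : Type*} [CommRing S] [IsDomain S] {N d : ℕ} {c : S}
    (hd : 0 < d) (hc : (d : S) * c = 1) {P : S[X]} (hP : P.Monic)
    (hPd : P.natDegree = N * d) :
    ∃ G : S[X], G.Monic ∧ G.natDegree = N ∧ (P - G ^ d).degree < (N * (d - 1) : ℕ) := by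
  suffices H : ∀ k : ℕ, ∃ G : S[X], G.Monic ∧ G.natDegree = N ∧
      (P - G ^ d).degree < ((N * (d - 1) + (N - k) : ℕ) : WithBot ℕ) by
    obtain ⟨G, h1, h2, h3⟩ := H N
    exact ⟨G, h1, h2, by simpa using h3⟩
  intro k
  induction k with
  | zero =>
    refine ⟨X ^ N, monic_X_pow N, natDegree_X_pow N, ?_⟩
    have e1 : N * (d - 1) + (N - 0) = N * d := by
      obtain ⟨d, rfl⟩ := Nat.exists_eq_succ_of_ne_zero hd.ne'
      simp; ring
    have hPdeg : P.degree = (N * d : ℕ) := by rw [degree_eq_natDegree hP.ne_zero, hPd]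
    rw [e1, ← hPdeg]
    apply degree_sub_lt_left
    · rw [hPdeg, ← pow_mul, degree_X_pow]
    · exact hP.ne_zero
    · rw [hP.leadingCoeff, ← pow_mul, (monic_X_pow _).leadingCoeff]
  | succ k ih =>
    obtain ⟨G, hG, hGN, hlt⟩ := ih
    rcases Nat.lt_or_ge k N with hkN | hkN
    swap
    · exact ⟨G, hG, hGN, by
        rwa [show N - (k + 1) = N - k by omega]⟩
    set i := N - (k + 1) with hi
    set b := (P - G ^ d).coeff (N * (d - 1) + i) with hb
    have hiN : i < N := by omega
    have hT : (C (c * b) * X ^ i).natDegree < N := (natDegree_C_mul_X_pow_le _ _).trans_lt hiN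
    have hT' : (C (c * b) * X ^ i).degree < G.degree := by
      rw [degree_eq_natDegree hG.ne_zero, hGN]
      exact (degree_C_mul_X_pow_le _ _).trans_lt (by exact_mod_cast hiN)
    set T := C (c * b) * X ^ i with hTdef
    have hm : (G + T).Monic := hG.add_of_left hT'
    have hmN : (G + T).natDegree = N := by
      rw [natDegree_add_eq_left_of_natDegree_lt (by rwa [hGN]), hGN]
    refine ⟨G + T, hm, hmN, ?_⟩
    set W := ∑ a ∈ Finset.range d, (G + T) ^ a * G ^ (d - 1 - a) with hW
    have hWd : W.natDegree ≤ N * (d - 1) := natDegree_geom_sum₂_le d hmN.le hGN.le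
    have hWc : W.coeff (N * (d - 1)) = d := by
      rw [hW, coeff_geom_sum₂ d hmN.le hGN.le (D := 1), one_pow, mul_one]
      · rw [← hmN]; exact hm.coeff_natDegree
      · rw [← hGN]; exact hG.coeff_natDegree
    have hTi : T.natDegree ≤ i := natDegree_C_mul_X_pow_le _ _
    have heq : P - (G + T) ^ d = (P - G ^ d) - W * T := by
      have := (Commute.all (G + T) G).geom_sum₂_mul d
      rw [← hW, add_sub_cancel_left] at this
      rw [this]
      ring
    rw [heq, degree_lt_iff_coeff_zero]
    rw [degree_lt_iff_coeff_zero] at hlt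
    intro m hm
    rw [coeff_sub]
    rcases hm.eq_or_lt with rfl | hm
    · rw [coeff_mul_add_eq_of_natDegree_le hWd hTi, hWc, ← hb, hTdef, coeff_C_mul_X_pow, if_pos rfl,
        ← mul_assoc, hc, one_mul, sub_self]
    · rw [hlt m (by omega), coeff_eq_zero_of_natDegree_lt, sub_zero]
      exact (natDegree_mul_le_of_le hWd hTi).trans_lt hm

namespace IsMinimal

/-- The comparison with an approximate root, which is where characteristic zero enters. -/
lemma val_nonneg_of_val_eq_add [CharZero K] (he : IsMinimal f g e) (hI : Indep f g) {N d : ℕ}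
    (hd : 2 ≤ d) (hN : 0 < N) (hn : f.natDegree = N * d)
    (hadd : ∀ i < N, val f g (e (i + N * (d - 1))) =
      val f g (e i) + ((d - 1 : ℕ) : ℤ) * val f g (e N))
    {P : K[X][X]} (hP : P.Monic) (hPn : P.natDegree = f.natDegree) (hP0 : subst f g P = 0) :
    0 ≤ val f g (e N) := by
  have hdK : (d : K) ≠ 0 := by exact_mod_cast (by omega : d ≠ 0)
  have hc : (d : K[X]) * C (d : K)⁻¹ = 1 := by
    rw [← C_eq_natCast, ← C_mul, mul_inv_cancel₀ hdK, C_1]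
  have hNn : N < f.natDegree := by rw [hn]; nlinarith
  have hNd : N * d = N + N * (d - 1) := by
    obtain ⟨d, rfl⟩ := Nat.exists_eq_succ_of_ne_zero (show d ≠ 0 by omega)
    simp; ring
  obtain ⟨G, hG, hGN, hlt⟩ := exists_approx_root (by omega) hc hP (hPn.trans hn)
  have hG0 := hG.ne_zero
  have hGv : 0 ≤ val f g G := by simp [val, hG.leadingCoeff]
  suffices H : ∀ k : ℕ, ∀ U : K[X][X], U ≠ 0 → U.natDegree = N → val f g U ≤ val f g (e N) →
      (C U.leadingCoeff * G - U).degree < k → 0 ≤ val f g (e N) by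
    exact H _ (e N) (he.ne_zero N hNn) (he.natDegree_eq N hNn) le_rfl
      (degree_le_natDegree.trans_lt (by exact_mod_cast Nat.lt_succ_self _))
  intro k
  induction k with
  | zero =>
    intro U hU hUN hUv hlt
    have h0 : C U.leadingCoeff * G - U = 0 := by
      rw [← degree_eq_bot]
      simpa using hlt
    have hU' : U = C U.leadingCoeff * G := (sub_eq_zero.mp h0).symm
    have hs : subst f g (C U.leadingCoeff) ≠ 0 :=
      hI _ (C_ne_zero.mpr (leadingCoeff_ne_zero.mpr hU)) (by rw [natDegree_C]; omega)
    have hCv : val f g (C U.leadingCoeff) = 0 := by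
      unfold val
      rw [subst_C, natDegree_comp, leadingCoeff_C]
      push_cast
      ring
    rw [hU', val_mul hs (hI G hG0 (hGN ▸ hNn)), hCv, zero_add] at hUv
    exact hGv.trans hUv
  | succ k ih =>
    intro U hU hUN hUv hltk
    set D := U.leadingCoeff with hD
    have hD0 : D ≠ 0 := leadingCoeff_ne_zero.mpr hU
    set r := C D * G - U with hr
    rcases eq_or_ne r 0 with hr0 | hr0
    · exact ih U hU hUN hUv (by rw [← hr, hr0, degree_zero]; exact WithBot.bot_lt_coe k)
    have hCGd : (C D * G).natDegree = N := by rw [natDegree_C_mul hD0, hGN]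
    have hCG0 : C D * G ≠ 0 := mul_ne_zero (C_ne_zero.mpr hD0) hG0
    have hrN : r.natDegree < N := by
      have : r.degree < (C D * G).degree := by
        apply degree_sub_lt_left _ hCG0
        · rw [leadingCoeff_mul, leadingCoeff_C, hG.leadingCoeff, mul_one, hD]
        · rw [degree_eq_natDegree hCG0, degree_eq_natDegree hU, hCGd, hUN]
      have := natDegree_lt_natDegree hr0 this
      rwa [hCGd] at this
    set i := r.natDegree with hi
    set c := r.leadingCoeff with hcdef
    have hc0 : c ≠ 0 := leadingCoeff_ne_zero.mpr hr0
    have hrk : i ≤ k := by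
      rw [degree_eq_natDegree hr0] at hltk
      have : i < k + 1 := by exact_mod_cast hltk
      omega
    -- the polynomial `D ^ d * P - U ^ d`
    set W := ∑ a ∈ Finset.range d, (C D * G) ^ a * U ^ (d - 1 - a) with hW
    have hWd : W.natDegree ≤ N * (d - 1) := natDegree_geom_sum₂_le d hCGd.le hUN.le
    have hWc : W.coeff (N * (d - 1)) = d * D ^ (d - 1) := by
      apply coeff_geom_sum₂ d hCGd.le hUN.le
      · rw [coeff_C_mul, ← hGN, hG.coeff_natDegree, mul_one]
      · rw [← hUN]; rfl
    set Q := C (D ^ d) * P - U ^ d with hQ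
    have hQW : Q = C (D ^ d) * (P - G ^ d) + W * r := by
      have := (Commute.all (C D * G) U).geom_sum₂_mul d
      rw [← hW, ← hr, mul_pow, ← C_pow] at this
      rw [this, hQ]
      ring
    have hQc : Q.coeff (N * (d - 1) + i) = d * D ^ (d - 1) * c := by
      rw [hQW, coeff_add, coeff_C_mul, (degree_lt_iff_coeff_zero _ _).mp hlt _ (by omega),
        mul_zero, zero_add, coeff_mul_add_eq_of_natDegree_le hWd hi.ge, hWc]
      rfl
    have hQc0 : (d : K[X]) * D ^ (d - 1) * c ≠ 0 :=
      mul_ne_zero (mul_ne_zero (left_ne_zero_of_mul_eq_one hc) (pow_ne_zero _ hD0)) hc0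
    have hQd : Q.natDegree = N * (d - 1) + i := by
      apply le_antisymm
      · rw [hQW]
        refine natDegree_add_le_of_degree_le ?_ (natDegree_mul_le_of_le hWd hi.ge)
        refine (natDegree_C_mul_le _ _).trans ?_
        rw [natDegree_le_iff_degree_le]
        exact hlt.le.trans (by exact_mod_cast Nat.le_add_right _ _)
      · exact le_natDegree_of_ne_zero (hQc ▸ hQc0)
    have hQl : Q.leadingCoeff = d * D ^ (d - 1) * c := by rw [leadingCoeff, hQd, hQc]
    have hQ0 : Q ≠ 0 := by
      rintro h0
      rw [h0, coeff_zero] at hQc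
      exact hQc0 hQc.symm
    have hQn : Q.natDegree < f.natDegree := by omega
    have hQv := he.val_le Q hQ0 hQn
    rw [hQd, add_comm, hadd i hrN] at hQv
    have hQs : (subst f g Q).natDegree = d * (subst f g U).natDegree := by
      rw [hQ, map_sub, map_mul, hP0, mul_zero, zero_sub, natDegree_neg, map_pow, natDegree_pow]
    have hlead : ((d : K[X]) * D ^ (d - 1) * c).natDegree =
        (d - 1) * D.natDegree + c.natDegree := by
      rw [mul_assoc, ← C_eq_natCast, natDegree_C_mul hdK,
        natDegree_mul (pow_ne_zero _ hD0) hc0, natDegree_pow]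
    have hin : i < f.natDegree := hrN.trans hNn
    -- the improved approximation
    have hEi := he.ne_zero i hin
    have hdi := he.natDegree_eq i hin
    set E := (e i).leadingCoeff with hE
    have hE0 : E ≠ 0 := leadingCoeff_ne_zero.mpr hEi
    have hlt1 : (C c * e i).natDegree < (C E * U).natDegree := by
      rwa [natDegree_C_mul hc0, natDegree_C_mul hE0, hdi, hUN]
    set V := C E * U + C c * e i with hV
    have hVN : V.natDegree = N := by
      rw [hV, natDegree_add_eq_left_of_natDegree_lt hlt1, natDegree_C_mul hE0, hUN]
    have hVl : V.leadingCoeff = E * D := by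
      rw [hV, leadingCoeff_add_of_degree_lt' (degree_lt_degree hlt1), leadingCoeff_mul,
        leadingCoeff_C]
    have hV0 : V ≠ 0 := by
      rw [← leadingCoeff_ne_zero, hVl]
      exact mul_ne_zero hE0 hD0
    have hVs : (subst f g V).natDegree ≤
        max (E.natDegree * f.natDegree + (subst f g U).natDegree)
          (c.natDegree * f.natDegree + (subst f g (e i)).natDegree) := by
      rw [hV, map_add, map_mul, map_mul, subst_C, subst_C]
      refine natDegree_add_le_of_le ?_ ?_
      · exact natDegree_mul_le_of_le natDegree_comp.le le_rfl
      · exact natDegree_mul_le_of_le natDegree_comp.le le_rfl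
    have hd1 : ((d - 1 : ℕ) : ℤ) = d - 1 := by omega
    apply ih V hV0 hVN
    · have hUv' : ((subst f g U).natDegree : ℤ) ≤ val f g (e N) + f.natDegree * D.natDegree := by
        unfold val at hUv ⊢
        rw [← hD] at hUv
        linarith
      have hei : ((subst f g (e i)).natDegree : ℤ) = val f g (e i) + f.natDegree * E.natDegree := by
        unfold val
        rw [← hE]
        ring
      have hQv' : val f g (e i) + (d - 1) * val f g (e N) ≤
          d * (subst f g U).natDegree -
            f.natDegree * ((d - 1) * D.natDegree + c.natDegree) := by
        rw [hd1] at hQv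
        refine hQv.trans (le_of_eq ?_)
        unfold val
        rw [hQs, hQl, hlead]
        push_cast [hd1]
        ring
      have hdU := mul_le_mul_of_nonneg_left hUv' (Int.natCast_nonneg d)
      rw [show val f g V = (subst f g V).natDegree - f.natDegree * V.leadingCoeff.natDegree
        from rfl, hVl, natDegree_mul hE0 hD0]
      zify at hVs
      push_cast
      rcases le_max_iff.mp hVs with h | h
      · linarith
      · linarith
    · rw [hVl]
      have heq : C (E * D) * G - V = C E * r - C c * e i := by
        rw [hV, hr, C_mul]
        ring
      rw [heq]
      have h1 : (C E * r).degree = (i : ℕ) := by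
        rw [degree_C_mul hE0, degree_eq_natDegree hr0]
      have h2 : (C c * e i).degree = (i : ℕ) := by
        rw [degree_C_mul hc0, degree_eq_natDegree hEi, hdi]
      have : (C E * r - C c * e i).degree < (C E * r).degree := by
        apply degree_sub_lt_left (h1.trans h2.symm) (mul_ne_zero (C_ne_zero.mpr hE0) hr0)
        rw [leadingCoeff_mul, leadingCoeff_mul, leadingCoeff_C, leadingCoeff_C, ← hE, ← hcdef,
          mul_comm]
      refine this.trans_le ?_
      rw [h1]
      exact_mod_cast hrk

lemma val_nonneg_aux [CharZero K] (he : IsMinimal f g e) (hf : f.Monic) (hI : Indep f g)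
    {P : K[X][X]} (hP : P.Monic) (hPn : P.natDegree = f.natDegree) (hP0 : subst f g P = 0)
    (d : ℕ) : ∀ N : ℕ, 0 < N → f.natDegree = N * d → (∀ i < N, (d : ℤ) ∣ val f g (e i)) → 2 ≤ d →
      0 ≤ val f g (e N) ∧
        ((∀ i < N, 0 ≤ val f g (e i)) → ∀ i < f.natDegree, 0 ≤ val f g (e i)) := by
  induction d using Nat.strong_induction_on with
  | _ d ih =>
  intro N hN hn hdvd hd
  have hNn : N < f.natDegree := by rw [hn]; nlinarith
  set w := val f g (e N) with hw
  set d' := Int.gcd d w with hd'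
  have hd'0 : 0 < d' := Int.gcd_pos_of_ne_zero_left _ (by omega)
  obtain ⟨q, hq⟩ : d' ∣ d := by exact_mod_cast Int.gcd_dvd_left (d : ℤ) w
  rw [mul_comm] at hq
  have hgcd : ∀ a : ℤ, (d : ℤ) ∣ a * w → (q : ℤ) ∣ a := by
    intro a ha
    have h1 : (d : ℤ) ∣ a * d' := by
      rw [hd', Int.gcd_eq_gcd_ab, mul_add, ← mul_assoc, ← mul_assoc]
      exact dvd_add ((dvd_mul_left _ _).mul_right _) (ha.mul_right _)
    rw [hq] at h1
    push_cast at h1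
    exact Int.dvd_of_mul_dvd_mul_right (by omega) h1
  have hadd := he.val_eq_add hf hI hN hNn hn hdvd hd'0 hq hgcd
  have hdw : ¬ (d : ℤ) ∣ w := by
    intro h
    obtain ⟨i, hi, h⟩ := he.exists_dvd_sub hf hI hN (by omega) hn hdvd h
    exact he.not_dvd_sub hf hI hi hNn h
  have hd'd : d' < d := by
    refine lt_of_le_of_ne (Nat.le_of_dvd (by omega) ⟨q, by rw [hq]; ring⟩) fun h => hdw ?_
    rw [← h]
    exact Int.gcd_dvd_right _ _
  have hnq : f.natDegree = (q * N) * d' := by rw [hn, hq]; ring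
  have hq0 : 0 < q := by
    rcases Nat.eq_zero_or_pos q with h | h
    · rw [h] at hq; omega
    · exact h
  have hstep : 0 ≤ w → (∀ i < N, 0 ≤ val f g (e i)) → ∀ i < q * N, 0 ≤ val f g (e i) := by
    intro h0 h i hi
    rw [hadd i hi]
    have := h _ (Nat.mod_lt i hN)
    positivity
  rcases Nat.lt_or_ge d' 2 with h1 | h2
  · have hd1 : d' = 1 := by omega
    rw [hd1, mul_one] at hq hnq
    have h0 : 0 ≤ w := by
      apply he.val_nonneg_of_val_eq_add hI hd hN hn _ hP hPn hP0
      intro i hi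
      have hlt : i + N * (d - 1) < q * N := by
        obtain ⟨d, rfl⟩ := Nat.exists_eq_succ_of_ne_zero (show d ≠ 0 by omega)
        rw [← hq]
        simp
        nlinarith
      rw [hadd _ hlt, Nat.add_mul_mod_self_left, Nat.mod_eq_of_lt hi,
        Nat.add_mul_div_left _ _ hN, Nat.div_eq_of_lt hi, zero_add]
    exact ⟨h0, fun h => by rw [hnq]; exact hstep h0 h⟩
  · have hqn : q * N < f.natDegree := by
      have : 0 < q * N := Nat.mul_pos hq0 hN
      rw [hnq]; nlinarith
    have := ih d' hd'd (q * N) (Nat.mul_pos hq0 hN) hnq (fun i hi => by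
      rw [hadd i hi]
      have h1 : (d' : ℤ) ∣ d := Int.gcd_dvd_left _ _
      exact dvd_add (h1.trans (hdvd _ (Nat.mod_lt i hN)))
        ((Int.gcd_dvd_right _ _).mul_left _)) h2
    have h0 : 0 ≤ w := by
      have hs := he.subst_ne_zero hI hNn
      have hdeg : (e N ^ q).natDegree = q * N := by rw [natDegree_pow, he.natDegree_eq N hNn]
      have h3 := he.val_le (e N ^ q) (pow_ne_zero _ (he.ne_zero N hNn)) (by rwa [hdeg])
      rw [hdeg, val_pow hs] at h3
      have h4 : 0 ≤ (q : ℤ) * w := this.1.trans h3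
      exact nonneg_of_mul_nonneg_right h4 (by exact_mod_cast hq0)
    exact ⟨h0, fun h => this.2 (hstep h0 h)⟩

lemma val_zero (he : IsMinimal f g e) (hn : 0 < f.natDegree) : val f g (e 0) = 0 := by
  have h := he.natDegree_eq 0 hn
  obtain ⟨a, ha⟩ := natDegree_eq_zero.mp h
  unfold val
  rw [← ha, subst_C, natDegree_comp, leadingCoeff_C]
  push_cast
  ring

theorem val_nonneg [CharZero K] (he : IsMinimal f g e) (hf : f.Monic) (hI : Indep f g)
    (hn : 2 ≤ f.natDegree) {P : K[X][X]} (hP : P.Monic) (hPn : P.natDegree = f.natDegree)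
    (hP0 : subst f g P = 0) : ∀ i < f.natDegree, 0 ≤ val f g (e i) := by
  have h0 := he.val_zero (by omega)
  refine (he.val_nonneg_aux hf hI hP hPn hP0 f.natDegree 1 one_pos (by ring) ?_ hn).2 ?_
  · intro i hi
    rw [Nat.lt_one_iff.mp hi, h0]
    exact dvd_zero _
  · intro i hi
    rw [Nat.lt_one_iff.mp hi, h0]

/-- Powers of `g` have minimal normalised degree as long as these are incongruent. -/
lemma val_eq_mul (he : IsMinimal f g e) (hI : Indep f g) {q : ℕ}
    (hq : ∀ k < q, 0 < k → ¬ f.natDegree ∣ k * g.natDegree) (hqn : q ≤ f.natDegree) (k : ℕ) :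
    k < q → val f g (e k) = k * g.natDegree := by
  induction k using Nat.strong_induction_on with
  | _ k ih =>
  intro hk
  have hv : val f g (X ^ k) = k * g.natDegree := by simp [val]
  rcases he.val_eq_or hI k (X ^ k) (pow_ne_zero _ X_ne_zero) (natDegree_X_pow k) (by omega)
    with h | ⟨j, hj, h⟩
  · rw [← h, hv]
  · rw [hv, ih j hj (by omega), ← sub_mul] at h
    refine absurd ?_ (hq (k - j) (by omega) (by omega))
    zify [hj.le]
    exact h

end IsMinimal

section Bases

open Matrix

lemma sum_comp_mul_X_pow_term_natDegree {n : ℕ} (hfn : f.natDegree = n) {c : K[X]} (i : ℕ)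
    (h : c.comp f * X ^ i ≠ 0) : (c.comp f * X ^ i).natDegree = c.natDegree * n + i := by
  rw [natDegree_mul_X_pow i (left_ne_zero_of_mul h), natDegree_comp, hfn]

/-- The powers `1, x, …, x ^ (n - 1)` are orthogonal over `K[f]` with respect to the degree. -/
lemma degree_sum_comp_mul_X_pow {n : ℕ} (hfn : f.natDegree = n) (c : Fin n → K[X]) :
    (∑ i, (c i).comp f * X ^ (i : ℕ)).degree =
      Finset.univ.sup fun i => ((c i).comp f * X ^ (i : ℕ)).degree := by
  apply degree_sum_eq_of_disjoint
  rintro i ⟨-, hi⟩ j ⟨-, hj⟩ hij h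
  have h' := natDegree_eq_of_degree_eq h
  rw [sum_comp_mul_X_pow_term_natDegree hfn _ hi,
    sum_comp_mul_X_pow_term_natDegree hfn _ hj] at h'
  apply hij
  have := congrArg (· % n) h'
  simp only [Nat.mul_add_mod_self_right, Nat.mod_eq_of_lt i.2, Nat.mod_eq_of_lt j.2] at this
  exact Fin.ext this

lemma comp_ne_zero (hn : 0 < f.natDegree) {a : K[X]} (ha : a ≠ 0) : a.comp f ≠ 0 := by
  intro h
  rcases comp_eq_zero_iff.mp h with h | ⟨-, h⟩
  · exact ha h
  · rw [h, natDegree_C] at hn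
    exact lt_irrefl _ hn

lemma natDegree_le_of_sum {n : ℕ} (hn : 0 < n) (hfn : f.natDegree = n) (c : Fin n → K[X])
    (i : Fin n) :
    (c i).natDegree * n ≤ (∑ i, (c i).comp f * X ^ (i : ℕ)).natDegree := by
  rcases eq_or_ne (c i) 0 with h | h
  · simp [h]
  have h1 : (c i).comp f * X ^ (i : ℕ) ≠ 0 :=
    mul_ne_zero (comp_ne_zero (hfn ▸ hn) h) (pow_ne_zero _ X_ne_zero)
  have h2 : ((c i).comp f * X ^ (i : ℕ)).degree ≤ (∑ i, (c i).comp f * X ^ (i : ℕ)).degree := by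
    rw [degree_sum_comp_mul_X_pow hfn c]
    exact Finset.le_sup (f := fun i : Fin n => ((c i).comp f * X ^ (i : ℕ)).degree)
      (Finset.mem_univ i)
  have h3 := natDegree_le_natDegree h2
  rw [sum_comp_mul_X_pow_term_natDegree hfn _ h1] at h3
  omega

lemma eq_zero_of_sum_eq_zero {n : ℕ} (hn : 0 < n) (hfn : f.natDegree = n) (c : Fin n → K[X])
    (h : ∑ i, (c i).comp f * X ^ (i : ℕ) = 0) : c = 0 := by
  funext i
  have h1 := degree_sum_comp_mul_X_pow hfn c
  rw [h, degree_zero, eq_comm, ← le_bot_iff, Finset.sup_le_iff] at h1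
  have h2 := degree_eq_bot.mp (le_bot_iff.mp (h1 i (Finset.mem_univ i)))
  by_contra h0
  exact mul_ne_zero (comp_ne_zero (hfn ▸ hn) h0) (pow_ne_zero _ X_ne_zero) h2

lemma exists_eq_sum_comp {n : ℕ} (hn : 0 < n) (hf : f.Monic) (hfn : f.natDegree = n) (k : ℕ) :
    ∀ p : K[X], p.natDegree ≤ k → ∃ c : Fin n → K[X], p = ∑ i, (c i).comp f * X ^ (i : ℕ) := by
  have hlow : ∀ p : K[X], p.natDegree < n →
      p = ∑ i : Fin n, (C (p.coeff i)).comp f * X ^ (i : ℕ) := by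
    intro p hp
    conv_lhs => rw [as_sum_range_C_mul_X_pow' p hp]
    rw [Finset.sum_range]
    simp
  induction k with
  | zero =>
    intro p hp
    exact ⟨_, hlow p (by omega)⟩
  | succ k ih =>
    intro p hp
    have hr : (p %ₘ f).natDegree < n := by
      rw [← hfn]
      exact natDegree_modByMonic_lt p hf (fun h => by rw [h, natDegree_one] at hfn; omega)
    obtain ⟨c, hc⟩ := ih (p /ₘ f) (by rw [natDegree_divByMonic p hf, hfn]; omega)
    refine ⟨fun i => C ((p %ₘ f).coeff i) + X * c i, ?_⟩
    conv_lhs => rw [← modByMonic_add_div p f, hlow _ hr, hc, Finset.mul_sum]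
    rw [← Finset.sum_add_distrib]
    refine Finset.sum_congr rfl fun i _ => ?_
    simp
    ring

/-- `g` satisfies a monic equation of degree `deg f` over `K[f]`. -/
lemma exists_monic_subst_eq_zero (hn : 0 < f.natDegree) (hf : f.Monic) (g : K[X]) :
    ∃ P : K[X][X], P.Monic ∧ P.natDegree = f.natDegree ∧ subst f g P = 0 := by
  choose A hA using fun i : Fin f.natDegree =>
    exists_eq_sum_comp hn hf rfl _ (g * X ^ (i : ℕ)) le_rfl
  let M : Matrix (Fin f.natDegree) (Fin f.natDegree) K[X] := Matrix.of A
  refine ⟨M.charpoly, M.charpoly_monic, by rw [M.charpoly_natDegree_eq_dim, Fintype.card_fin], ?_⟩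
  have h1 : subst f g M.charpoly = (M.charpoly.map (compRingHom f)).eval g := by
    rw [eval_map]
    rfl
  rw [h1, ← charpoly_map, eval_charpoly, ← Matrix.exists_mulVec_eq_zero_iff]
  refine ⟨fun i => X ^ (i : ℕ), fun h => by simpa using congrFun h ⟨0, hn⟩, ?_⟩
  funext i
  rw [Matrix.sub_mulVec]
  simp only [Pi.sub_apply, Pi.zero_apply, Matrix.scalar_apply, Matrix.mulVec_diagonal]
  rw [hA i, sub_eq_zero]
  simp [Matrix.mulVec, dotProduct, M]

lemma subst_surjective (hgen : Algebra.adjoin K ({f, g} : Set K[X]) = ⊤) :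
    Function.Surjective (subst f g) := by
  intro p
  have hp : p ∈ Algebra.adjoin K ({f, g} : Set K[X]) := hgen ▸ Algebra.mem_top
  induction hp using Algebra.adjoin_induction with
  | mem x hx =>
    rcases hx with rfl | rfl
    · exact ⟨C X, by simp⟩
    · exact ⟨X, by simp⟩
  | algebraMap r => exact ⟨C (C r), by simp⟩
  | add x y _ _ hx hy =>
    obtain ⟨a, rfl⟩ := hx
    obtain ⟨b, rfl⟩ := hy
    exact ⟨a + b, map_add _ _ _⟩
  | mul x y _ _ hx hy =>
    obtain ⟨a, rfl⟩ := hx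
    obtain ⟨b, rfl⟩ := hy
    exact ⟨a * b, map_mul _ _ _⟩

lemma eq_sum_fin {n : ℕ} {Q : K[X][X]} (hQ : Q.natDegree < n) :
    Q = ∑ k : Fin n, C (Q.coeff k) * X ^ (k : ℕ) := by
  conv_lhs => rw [as_sum_range_C_mul_X_pow' Q hQ]
  rw [Finset.sum_range]

/-- The change of basis between the powers of `x` and the powers of `g` over `K[f]`. -/
lemma exists_change_of_basis {n : ℕ} (hn : 0 < n) (hf : f.Monic) (hfn : f.natDegree = n)
    (hgen : Algebra.adjoin K ({f, g} : Set K[X]) = ⊤) :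
    ∃ B T : Matrix (Fin n) (Fin n) K[X], B * T = 1 ∧ T * B = 1 ∧ ∀ q : Fin n → K[X],
      subst f g (∑ k : Fin n, C (q k) * X ^ (k : ℕ)) =
        ∑ i : Fin n, ((q ᵥ* T) i).comp f * X ^ (i : ℕ) := by
  obtain ⟨P, hP, hPn, hP0⟩ := exists_monic_subst_eq_zero (hfn ▸ hn) hf g
  have hlow : ∀ p : K[X], ∃ Q : K[X][X], Q.natDegree < n ∧ subst f g Q = p := by
    intro p
    obtain ⟨Q, rfl⟩ := subst_surjective hgen p
    refine ⟨Q %ₘ P, ?_, ?_⟩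
    · rw [← hfn, ← hPn]
      refine natDegree_modByMonic_lt Q hP fun h => ?_
      rw [h, natDegree_one] at hPn
      omega
    · conv_rhs => rw [← modByMonic_add_div Q P, map_add, map_mul, hP0, zero_mul, add_zero]
  choose T hT using fun k : Fin n => exists_eq_sum_comp hn hf hfn _ (g ^ (k : ℕ)) le_rfl
  choose Q hQn hQ using fun i : Fin n => hlow (X ^ (i : ℕ))
  have key : ∀ q : Fin n → K[X],
      subst f g (∑ k : Fin n, C (q k) * X ^ (k : ℕ)) =
        ∑ i : Fin n, ((q ᵥ* Matrix.of T) i).comp f * X ^ (i : ℕ) := by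
    intro q
    have h1 : ∀ i, ((q ᵥ* Matrix.of T) i).comp f = ∑ k, (q k).comp f * (T k i).comp f := by
      intro i
      simp only [← subst_C f g]
      simp [vecMul, dotProduct]
    simp only [h1, Finset.sum_mul]
    rw [Finset.sum_comm, map_sum]
    refine Finset.sum_congr rfl fun k _ => ?_
    rw [map_mul, map_pow, subst_C, subst_X, hT k, Finset.mul_sum]
    refine Finset.sum_congr rfl fun i _ => by ring
  have hBT : Matrix.of (fun i k : Fin n => (Q i).coeff k) * Matrix.of T = 1 := by
    funext i
    have h1 := hQ i
    rw [eq_sum_fin (hQn i), key] at h1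
    have h2 : ∑ j : Fin n, ((1 : Matrix (Fin n) (Fin n) K[X]) i j).comp f * X ^ (j : ℕ) =
        X ^ (i : ℕ) := by
      rw [Finset.sum_eq_single i]
      · simp
      · intro j _ hj
        simp [Matrix.one_apply_ne' hj]
      · simp
    rw [← sub_eq_zero]
    apply eq_zero_of_sum_eq_zero hn hfn
    simp only [Pi.sub_apply, sub_comp, sub_mul, Finset.sum_sub_distrib]
    rw [h2, sub_eq_zero]
    exact h1
  exact ⟨_, _, hBT, mul_eq_one_comm.mp hBT, key⟩



variable {n : ℕ} {B T : Matrix (Fin n) (Fin n) K[X]}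

lemma indep_of_change_of_basis (hn : 0 < n) (hfn : f.natDegree = n) (hTB : T * B = 1)
    (key : ∀ q : Fin n → K[X], subst f g (∑ k : Fin n, C (q k) * X ^ (k : ℕ)) =
        ∑ i : Fin n, ((q ᵥ* T) i).comp f * X ^ (i : ℕ)) : Indep f g := by
  intro Q hQ hQn h
  rw [hfn] at hQn
  rw [eq_sum_fin hQn, key] at h
  have h1 := eq_zero_of_sum_eq_zero hn hfn _ h
  have h2 : (fun k : Fin n => Q.coeff k) = 0 := by
    rw [← vecMul_one (fun k : Fin n => Q.coeff k), ← hTB, ← vecMul_vecMul, h1, zero_vecMul]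
  exact leadingCoeff_ne_zero.mpr hQ (congrFun h2 ⟨Q.natDegree, hQn⟩)

lemma exists_le_val (hn : 0 < n) (hfn : f.natDegree = n) (hTB : T * B = 1)
    (key : ∀ q : Fin n → K[X], subst f g (∑ k : Fin n, C (q k) * X ^ (k : ℕ)) =
        ∑ i : Fin n, ((q ᵥ* T) i).comp f * X ^ (i : ℕ)) :
    ∃ b : ℤ, ∀ Q : K[X][X], Q.natDegree < f.natDegree → b ≤ val f g Q := by
  set b : ℕ := ∑ i, ∑ k, (B i k).natDegree with hb
  refine ⟨-(n * b : ℕ), fun Q hQn => ?_⟩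
  rw [hfn] at hQn
  set q : Fin n → K[X] := fun k => Q.coeff k with hq
  have h1 := key q
  rw [← eq_sum_fin hQn] at h1
  have h2 : ∀ i, ((q ᵥ* T) i).natDegree * n ≤ (subst f g Q).natDegree := by
    rw [h1]
    exact natDegree_le_of_sum hn hfn _
  have h3 : q = (q ᵥ* T) ᵥ* B := by rw [vecMul_vecMul, hTB, vecMul_one]
  have h4 : Q.leadingCoeff = ∑ i, (q ᵥ* T) i * B i ⟨Q.natDegree, hQn⟩ :=
    congrFun h3 ⟨Q.natDegree, hQn⟩
  have h5 : Q.leadingCoeff.natDegree ≤ (subst f g Q).natDegree / n + b := by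
    rw [h4]
    refine natDegree_sum_le_of_forall_le _ _ fun i _ => natDegree_mul_le_of_le ?_ ?_
    · rw [Nat.le_div_iff_mul_le hn]
      exact h2 i
    · refine (Finset.single_le_sum (f := fun k => (B i k).natDegree) (fun _ _ => Nat.zero_le _)
        (Finset.mem_univ (⟨Q.natDegree, hQn⟩ : Fin n))).trans ?_
      exact Finset.single_le_sum (f := fun i => ∑ k, (B i k).natDegree)
        (fun _ _ => Nat.zero_le _) (Finset.mem_univ i)
  have h6 : n * Q.leadingCoeff.natDegree ≤ (subst f g Q).natDegree + n * b := by
    refine (Nat.mul_le_mul_left n h5).trans ?_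
    rw [mul_add]
    exact Nat.add_le_add_right (Nat.mul_div_le _ _) _
  unfold val
  rw [hfn]
  zify at h6
  push_cast
  linarith

lemma exists_isMinimal {b : ℤ} (hb : ∀ Q : K[X][X], Q.natDegree < f.natDegree → b ≤ val f g Q) :
    ∃ e : ℕ → K[X][X], IsMinimal f g e := by
  have H : ∀ k < f.natDegree, ∃ E : K[X][X], (E ≠ 0 ∧ E.natDegree = k) ∧
      ∀ Q : K[X][X], Q ≠ 0 → Q.natDegree = k → val f g E ≤ val f g Q := by
    intro k hk
    obtain ⟨v, ⟨E, hE, hEk, rfl⟩, hv⟩ := Int.exists_least_of_bdd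
      (P := fun v => ∃ E : K[X][X], E ≠ 0 ∧ E.natDegree = k ∧ val f g E = v)
      ⟨b, by
        rintro z ⟨E, -, hEk, rfl⟩
        exact hb E (hEk ▸ hk)⟩
      ⟨_, X ^ k, pow_ne_zero _ X_ne_zero, natDegree_X_pow k, rfl⟩
    exact ⟨E, ⟨hE, hEk⟩, fun Q hQ hQk => hv _ ⟨Q, hQ, hQk, rfl⟩⟩
  choose! e he1 he2 using H
  exact ⟨e, fun k hk => (he1 k hk).1, fun k hk => (he1 k hk).2,
    fun Q hQ hQn => he2 _ hQn Q hQ rfl⟩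

/-- If all minimal normalised degrees are nonnegative, they are less than `deg f`. -/
lemma IsMinimal.val_lt (he : IsMinimal f g e) (hn : 0 < n) (hfn : f.natDegree = n)
    (hBT : B * T = 1) (hTB : T * B = 1)
    (key : ∀ q : Fin n → K[X], subst f g (∑ k : Fin n, C (q k) * X ^ (k : ℕ)) =
        ∑ i : Fin n, ((q ᵥ* T) i).comp f * X ^ (i : ℕ))
    (hnonneg : ∀ k < n, 0 ≤ val f g (e k)) {k : ℕ} (hk : k < n) : val f g (e k) < n := by
  set α : Fin n → K[X] := fun i => C ((T ⟨k, hk⟩ i).eval 0) with hα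
  set q := α ᵥ* B with hq
  set Q : K[X][X] := ∑ k : Fin n, C (q k) * X ^ (k : ℕ) with hQ
  have hQs : subst f g Q = ∑ i : Fin n, (α i).comp f * X ^ (i : ℕ) := by
    rw [hQ, key, hq, vecMul_vecMul, hBT, vecMul_one]
  have hsn : (subst f g Q).natDegree < n := by
    have : (subst f g Q).natDegree ≤ n - 1 := by
      rw [hQs]
      refine natDegree_sum_le_of_forall_le _ _ fun i _ => ?_
      rw [hα, C_comp]
      exact (natDegree_C_mul_X_pow_le _ _).trans (by omega)
    omega
  have hQc : ∀ j : Fin n, Q.coeff j = q j := by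
    intro j
    rw [hQ, finsetSum_coeff, Finset.sum_eq_single j]
    · simp
    · intro i _ hij
      rw [coeff_C_mul_X_pow, if_neg]
      exact fun h => hij (Fin.ext h.symm)
    · simp
  have hQd : Q.natDegree < n := by
    have : Q.natDegree ≤ n - 1 :=
      natDegree_sum_le_of_forall_le _ _ fun i _ =>
        (natDegree_C_mul_X_pow_le _ _).trans (by omega)
    omega
  have hq0 : ∀ j, (q j).eval 0 = if (⟨k, hk⟩ : Fin n) = j then 1 else 0 := by
    intro j
    have h := congrArg (eval 0) (congrFun (congrFun hTB ⟨k, hk⟩) j)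
    rw [Matrix.mul_apply, eval_finsetSum] at h
    rw [hq]
    simp only [vecMul, dotProduct, eval_finsetSum, hα, eval_mul, eval_C]
    simp only [eval_mul] at h
    rw [h, Matrix.one_apply]
    split_ifs <;> simp
  have hQ0 : Q ≠ 0 := by
    intro h
    have h1 := hq0 ⟨k, hk⟩
    rw [← hQc, h] at h1
    simp at h1
  have hv := he.val_le Q hQ0 (hfn ▸ hQd)
  have hv0 := (hnonneg _ hQd).trans hv
  have hld : Q.leadingCoeff.natDegree = 0 := by
    unfold val at hv0
    rw [hfn] at hv0
    by_contra hne
    have : n * 1 ≤ n * Q.leadingCoeff.natDegree := Nat.mul_le_mul_left n (by omega)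
    zify at this
    omega
  have hl0 : Q.leadingCoeff.eval 0 ≠ 0 := by
    obtain ⟨a, ha⟩ := natDegree_eq_zero.mp hld
    have := leadingCoeff_ne_zero.mpr hQ0
    rw [← ha] at this ⊢
    simpa using this
  have hlq : Q.leadingCoeff = q ⟨Q.natDegree, hQd⟩ := hQc ⟨Q.natDegree, hQd⟩
  rw [hlq, hq0] at hl0
  have hkQ : k = Q.natDegree := by
    by_contra hne
    rw [if_neg (fun h => hne (congrArg Fin.val h))] at hl0
    exact hl0 rfl
  rw [← hkQ] at hv
  refine hv.trans_lt ?_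
  unfold val
  rw [hld]
  push_cast
  omega

end Bases

end PlaneLine

/-- If `K` is an algebraically closed field of characteristic zero, `f, g ∈ K[x]` are
monic with `deg f = n > deg g = m ≥ 1`, and `K[f,g] = K[x]`, then `m ∣ n`. -/
theorem stmt_17 (K : Type*) [Field K] [IsAlgClosed K] [CharZero K]
    (f g : Polynomial K) (hf : f.Monic) (hg : g.Monic)
    (hdeg : g.natDegree < f.natDegree) (hm : 1 ≤ g.natDegree)
    (hgen : Algebra.adjoin K ({f, g} : Set (Polynomial K)) = ⊤) :
    g.natDegree ∣ f.natDegree := by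
  have hn : 0 < f.natDegree := by omega
  obtain ⟨B, T, hBT, hTB, key⟩ := PlaneLine.exists_change_of_basis hn hf rfl hgen
  have hI := PlaneLine.indep_of_change_of_basis hn rfl hTB key
  obtain ⟨b, hb⟩ := PlaneLine.exists_le_val hn rfl hTB key
  obtain ⟨e, he⟩ := PlaneLine.exists_isMinimal hb
  obtain ⟨P, hP, hPn, hP0⟩ := PlaneLine.exists_monic_subst_eq_zero hn hf g
  have hnonneg := he.val_nonneg hf hI (by omega) hP hPn hP0
  have hlt := fun k hk => he.val_lt hn rfl hBT hTB key hnonneg (k := k) hk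
  set n := f.natDegree with hndef
  set m := g.natDegree with hmdef
  by_contra hmn
  obtain ⟨q, hq⟩ : Nat.gcd n m ∣ n := Nat.gcd_dvd_left n m
  obtain ⟨s, hs⟩ : Nat.gcd n m ∣ m := Nat.gcd_dvd_right n m
  have hd0 : 0 < Nat.gcd n m := Nat.gcd_pos_of_pos_left _ hn
  have hcop : Nat.Coprime q s := by
    have h := Nat.coprime_div_gcd_div_gcd hd0
    rwa [Nat.div_eq_of_eq_mul_right hd0 hq, Nat.div_eq_of_eq_mul_right hd0 hs] at h
  set d := Nat.gcd n m with hd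
  have hs2 : 2 ≤ s := by
    by_contra h
    have : s = 0 ∨ s = 1 := by omega
    rcases this with rfl | rfl
    · omega
    · rw [mul_one] at hs
      exact hmn ⟨q, by rw [hs]; exact hq⟩
  have hq0 : 0 < q := Nat.pos_of_ne_zero fun h => by rw [h] at hq; omega
  have hqn : q ≤ n := by rw [hq]; exact Nat.le_mul_of_pos_left _ hd0
  have hdvd : ∀ k < q, 0 < k → ¬ n ∣ k * m := by
    intro k hkq hk h
    rw [hq, hs, mul_left_comm] at h
    exact absurd (Nat.le_of_dvd hk (hcop.dvd_of_dvd_mul_right (Nat.dvd_of_mul_dvd_mul_left hd0 h)))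
      (not_le.mpr hkq)
  have h1 := he.val_eq_mul hI hdvd hqn (q - 1) (by omega)
  have h2 := hlt (q - 1) (by omega)
  rw [h1] at h2
  have h3 : (q - 1) * m < n := by exact_mod_cast h2
  obtain ⟨r, rfl⟩ := Nat.exists_eq_succ_of_ne_zero hq0.ne'
  rw [Nat.succ_sub_one] at h3
  have hsr : s < r.succ := by
    rw [hq, hs] at hdeg
    exact lt_of_mul_lt_mul_left hdeg (Nat.zero_le _)
  rw [hq, hs, mul_left_comm] at h3
  have h4 : r * s < r + 1 := lt_of_mul_lt_mul_left h3 (Nat.zero_le _)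
  nlinarith
end
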